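/- Let O be a tiled local order in M_n(D_p). Then O^• has finite elasticity (ρ(O^•) < ∞) if and only if O is hereditary. -/

import Mathlib

open scoped ENNReal

namespace Paper

section Factorization

variable {M : Type*}

/-- `a` is an atom (irreducible element) of the monoid `M`. -/
def IsAtomM [Monoid M] (a : M) : Prop :=
  ¬ IsUnit a ∧ ∀ b c : M, a = b * c → IsUnit b ∨ IsUnit c

/-- `a` has a factorization of length `k`: it is a unit times a product of `k` atoms. -/
def HasLen [Monoid M] (a : M) (k : ℕ) : Prop :=
  ∃ (ε : M) (u : Fin k → M), IsUnit ε ∧ (∀ i, IsAtomM (u i)) ∧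
    a = ε * (List.ofFn u).prod

/-- The set of lengths `L(a)` of `a`. -/
def LenSet [Monoid M] (a : M) : Set ℕ := {k | HasLen a k}

/-- A monoid is atomic if every element admits a factorization into atoms. -/
def Atomic (M : Type*) [Monoid M] : Prop := ∀ a : M, ∃ k : ℕ, HasLen a k

/-- `sup L(a)`, valued in `ℝ≥0∞`. -/
noncomputable def supLen [Monoid M] (a : M) : ℝ≥0∞ :=
  ⨆ k ∈ LenSet a, (k : ℝ≥0∞)

/-- `min L(a)`. -/
noncomputable def minLen [Monoid M] (a : M) : ℕ := sInf (LenSet a)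

open Classical in
/-- The elasticity `ρ(a) = sup L(a) / min L(a)` of an element (`1` for units). -/
noncomputable def elastOf [Monoid M] (a : M) : ℝ≥0∞ :=
  if IsUnit a then 1 else supLen a / (minLen a : ℝ≥0∞)

/-- The elasticity `ρ(M) = sup {ρ(a) | a ∈ M}` of a monoid. -/
noncomputable def elasticity (M : Type*) [Monoid M] : ℝ≥0∞ :=
  ⨆ a : M, elastOf a

/-- The refined elasticity `ρ_k(M) = sup {sup L(a) | min L(a) ≤ k}`. -/
noncomputable def refinedElasticity (M : Type*) [Monoid M] (k : ℕ) : ℝ≥0∞ :=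
  ⨆ a : M, ⨆ (_ : minLen a ≤ k), supLen a

/-- The union `U_k(M)` of sets of lengths containing `k`. -/
def lengthUnion (M : Type*) [Monoid M] (k : ℕ) : Set ℕ :=
  {m | ∃ a : M, k ∈ LenSet a ∧ m ∈ LenSet a}

/-- Transfer homomorphism between monoids. -/
def IsTransferHom {M N : Type*} [Monoid M] [Monoid N] (φ : M →* N) : Prop :=
  (∀ a : M, IsUnit (φ a) ↔ IsUnit a) ∧
  (∀ d : N, ∃ (u v : Nˣ) (a : M), d = ↑u * φ a * ↑v) ∧
  (∀ (a : M) (b₁ b₂ : N), φ a = b₁ * b₂ →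
    ∃ (a₁ a₂ : M) (ε : Nˣ), a = a₁ * a₂ ∧ φ a₁ = b₁ * ↑ε ∧ φ a₂ = ↑ε⁻¹ * b₂)

/-- The restricted product `∏'_{i ∈ I} T_i` of a family of monoids: all but finitely
many components are units. -/
def restrictedProd {I : Type*} (T : I → Type*) [∀ i, Monoid (T i)] :
    Submonoid (∀ i, T i) where
  carrier := {α | {i | ¬ IsUnit (α i)}.Finite}
  one_mem' := by
    have : {i | ¬ IsUnit ((1 : ∀ i, T i) i)} = ∅ := by
      ext i; simp
    simp only [Set.mem_setOf_eq, this]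
    exact Set.finite_empty
  mul_mem' := by
    intro a b ha hb
    refine Set.Finite.subset (Set.Finite.union ha hb) ?_
    intro i hi
    by_contra h
    simp only [Set.mem_union, Set.mem_setOf_eq, not_or] at h  -- h : IsUnit (a i) ∧ IsUnit (b i)? no
    exact hi (IsUnit.mul (not_not.mp h.1) (not_not.mp h.2))

/-- A zero-sumfree sequence over a commutative monoid (written multiplicatively):
no nonempty subsequence has product `1`. -/
def ZeroSumfree {G : Type*} [CommMonoid G] (s : Multiset G) : Prop :=
  ∀ t : Multiset G, t ≤ s → t ≠ 0 → t.prod ≠ 1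

/-- The Davenport constant: `1 +` the maximal length of a zero-sumfree sequence. -/
noncomputable def davenport (G : Type*) [CommMonoid G] : ℕ :=
  1 + sSup {n : ℕ | ∃ s : Multiset G, ZeroSumfree s ∧ Multiset.card s = n}

/-- The `T`-block monoid `B_T(G, ι)` over `G` induced by `ι : T → G`: pairs `(S, α)`
of a sequence `S ∈ F(G)` and `α ∈ T` with `σ(S)·ι(α) = 1`. -/
def blockMonoid {G T : Type*} [CommMonoid G] [Monoid T] (ι : T →* G) :
    Submonoid (Multiplicative (Multiset G) × T) where
  carrier := {x | (Multiplicative.toAdd x.1).prod * ι x.2 = 1}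
  one_mem' := by simp
  mul_mem' := by
    intro a b ha hb
    simp only [Set.mem_setOf_eq, Prod.fst_mul, Prod.snd_mul, toAdd_mul, Multiset.prod_add,
      map_mul] at *
    rw [mul_mul_mul_comm, ha, hb, one_mul]

/-- Every right ideal is projective. -/
def IsHereditaryRing (R : Type*) [Ring R] : Prop :=
  ∀ I : Submodule Rᵐᵒᵖ R, Module.Projective Rᵐᵒᵖ I

end Factorization

end Paper

namespace Paper

/-- The data of a central division algebra `D` over a non-archimedean local field `K_p`
(a completion of a number field at a finite place), together with its (normalized discrete)
valuations `v` on `K_p` and `w = v ∘ nrd` on `D`, a uniformizer `π` of `R_p`, a generator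
`ϖ` of the maximal ideal of the unique maximal order `Δ_p = {x | w x ≥ 0}`, and the
reduced norms of the matrix algebras `M_ι(D)`, characterized via the reduced
characteristic polynomial. -/
structure LocalCSA where
  /-- the local field `K_p` -/
  Kp : Type
  [fieldKp : Field Kp]
  /-- the normalized discrete valuation on `K_p` -/
  v : Kp → ℤ
  v_mul : ∀ x y : Kp, x ≠ 0 → y ≠ 0 → v (x * y) = v x + v y
  v_add : ∀ x y : Kp, x ≠ 0 → y ≠ 0 → x + y ≠ 0 → min (v x) (v y) ≤ v (x + y)
  v_neg : ∀ x : Kp, v (-x) = v x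
  /-- a uniformizer of the valuation ring `R_p` -/
  piK : Kp
  piK_ne : piK ≠ 0
  v_piK : v piK = 1
  /-- `K_p` is complete with respect to `v` -/
  complete : ∀ f : ℕ → Kp,
    (∀ N : ℤ, ∃ M : ℕ, ∀ m n : ℕ, M ≤ m → M ≤ n → f m - f n = 0 ∨ N ≤ v (f m - f n)) →
    ∃ L : Kp, ∀ N : ℤ, ∃ M : ℕ, ∀ m : ℕ, M ≤ m → f m - L = 0 ∨ N ≤ v (f m - L)
  /-- the central division algebra `D_p` -/
  D : Type
  [divD : DivisionRing D]
  [algD : Algebra Kp D]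
  [fdD : FiniteDimensional Kp D]
  centralD : Subalgebra.center Kp D = ⊥
  /-- the degree `d` of `D_p`, so `dim_{K_p} D_p = d²` -/
  d : ℕ
  degD : Module.finrank Kp D = d * d
  /-- the valuation `w = v ∘ nrd` on `D_p` -/
  w : D → ℤ
  w_mul : ∀ x y : D, x ≠ 0 → y ≠ 0 → w (x * y) = w x + w y
  w_add : ∀ x y : D, x ≠ 0 → y ≠ 0 → x + y ≠ 0 → min (w x) (w y) ≤ w (x + y)
  w_neg : ∀ x : D, w (-x) = w x
  w_algebraMap : ∀ x : Kp, x ≠ 0 → w (algebraMap Kp D x) = d * v x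
  w_surj : ∀ k : ℤ, ∃ x : D, x ≠ 0 ∧ w x = k
  /-- a generator `ϖ` of the maximal ideal `𝔓` of `Δ_p` -/
  ϖ : D
  ϖ_ne : ϖ ≠ 0
  w_ϖ : w ϖ = 1
  /-- the reduced norm of the central simple algebra `M_ι(D_p)` over `K_p` -/
  nrd : ∀ {ι : Type} [Fintype ι] [DecidableEq ι], Matrix ι ι D → Kp
  nrd_mul : ∀ {ι : Type} [Fintype ι] [DecidableEq ι] (B C : Matrix ι ι D),
    nrd (B * C) = nrd B * nrd C
  nrd_one : ∀ {ι : Type} [Fintype ι] [DecidableEq ι], nrd (1 : Matrix ι ι D) = 1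
  nrd_charpoly : ∀ {ι : Type} [Fintype ι] [DecidableEq ι] (B : Matrix ι ι D),
    ∃ f : Polynomial Kp, f.Monic ∧ f.natDegree = Fintype.card ι * d ∧
      f ^ (Fintype.card ι * d) = LinearMap.charpoly (LinearMap.mulLeft Kp B) ∧
      nrd B = (-1) ^ (Fintype.card ι * d) * f.coeff 0
  /-- cancellative = nonzero reduced norm = invertible over `M_ι(D_p)` -/
  nrd_unit : ∀ {ι : Type} [Fintype ι] [DecidableEq ι] (B : Matrix ι ι D),
    nrd B ≠ 0 ↔ IsUnit B
  /-- the reduced norm of a matrix with integral entries is integral -/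
  nrd_int : ∀ {ι : Type} [Fintype ι] [DecidableEq ι] (B : Matrix ι ι D),
    (∀ i j, B i j = 0 ∨ 0 ≤ w (B i j)) → nrd B = 0 ∨ 0 ≤ v (nrd B)

attribute [instance] LocalCSA.fieldKp LocalCSA.divD LocalCSA.algD LocalCSA.fdD

namespace LocalCSA

variable (L : LocalCSA)

lemma w_one : L.w 1 = 0 := by
  have h := L.w_mul 1 1 one_ne_zero one_ne_zero
  rw [one_mul] at h
  omega

/-- The unique maximal order `Δ_p = {x ∈ D_p | w(x) ≥ 0}`. -/
def Delta : Set L.D := {x | x = 0 ∨ 0 ≤ L.w x}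

/-- The fractional-power `𝔓^m = {x ∈ D_p | w(x) ≥ m}` of the maximal ideal of `Δ_p`. -/
def Ppow (m : ℤ) : Set L.D := {x | x = 0 ∨ m ≤ L.w x}

lemma Ppow_zero_mem (m : ℤ) : (0 : L.D) ∈ L.Ppow m := Or.inl rfl

lemma Ppow_add_mem {m : ℤ} {x y : L.D} (hx : x ∈ L.Ppow m) (hy : y ∈ L.Ppow m) :
    x + y ∈ L.Ppow m := by
  by_cases hx0 : x = 0
  · subst hx0; simpa using hy
  by_cases hy0 : y = 0
  · subst hy0; simpa using hx
  by_cases hxy : x + y = 0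
  · exact Or.inl hxy
  have hwx : m ≤ L.w x := hx.resolve_left hx0
  have hwy : m ≤ L.w y := hy.resolve_left hy0
  exact Or.inr (le_trans (le_min hwx hwy) (L.w_add x y hx0 hy0 hxy))

lemma Ppow_mul_mem {s t : ℤ} {x y : L.D} (hx : x ∈ L.Ppow s) (hy : y ∈ L.Ppow t) :
    x * y ∈ L.Ppow (s + t) := by
  by_cases hx0 : x = 0
  · exact Or.inl (by simp [hx0])
  by_cases hy0 : y = 0
  · exact Or.inl (by simp [hy0])
  have hwx : s ≤ L.w x := hx.resolve_left hx0
  have hwy : t ≤ L.w y := hy.resolve_left hy0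
  exact Or.inr (by rw [L.w_mul x y hx0 hy0]; omega)

lemma Ppow_neg_mem {m : ℤ} {x : L.D} (hx : x ∈ L.Ppow m) : -x ∈ L.Ppow m := by
  rcases hx with rfl | hx
  · exact Or.inl (by simp)
  · exact Or.inr (by rw [L.w_neg]; exact hx)

lemma Ppow_mono {s t : ℤ} (h : s ≤ t) : L.Ppow t ⊆ L.Ppow s := by
  intro x hx
  rcases hx with rfl | hx
  · exact Or.inl rfl
  · exact Or.inr (le_trans h hx)

lemma Ppow_one_mem {m : ℤ} (h : m ≤ 0) : (1 : L.D) ∈ L.Ppow m := by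
  exact Or.inr (by rw [L.w_one]; exact h)

end LocalCSA

end Paper

namespace Paper

namespace LocalCSA

variable (L : LocalCSA)

/-- The exponent matrix conditions for a tiled order in standard form. -/
def IsStdForm {r : ℕ} (m : Fin r → Fin r → ℤ) : Prop :=
  (∀ i, m i i = 0) ∧ (∀ i j k, m i k ≤ m i j + m j k) ∧ (∀ i j, i ≠ j → 0 < m i j + m j i)

/-- The block index set of the partition `ñ = (n_1, …, n_r)` of `n`: an index in block
`i` is a pair `⟨i, x⟩` with `x ∈ Fin (n_i)`. -/
abbrev BlockIdx {r : ℕ} (nv : Fin r → ℕ) : Type := (i : Fin r) × Fin (nv i)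

/-- The underlying set of the order `O(ñ, M) = ⊕_{i,j} M_{n_i × n_j}(𝔓^{m_{ij}})`,
for matrices indexed by an index set `ι` with block-assignment `β : ι → Fin r`. -/
def stdSet {r : ℕ} (m : Fin r → Fin r → ℤ) {ι : Type} (β : ι → Fin r) :
    Set (Matrix ι ι L.D) :=
  {B | ∀ a b : ι, B a b ∈ L.Ppow (m (β a) (β b))}

/-- The order `O(ñ, M)` as a subring of the matrix algebra. -/
def stdOrder {r : ℕ} (m : Fin r → Fin r → ℤ) {ι : Type} [Fintype ι] [DecidableEq ι]
    (β : ι → Fin r) (h0 : ∀ i, m i i = 0) (htri : ∀ i j k, m i k ≤ m i j + m j k) :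
    Subring (Matrix ι ι L.D) where
  carrier := L.stdSet m β
  zero_mem' := fun a b => by simpa using L.Ppow_zero_mem _
  one_mem' := by
    intro a b
    by_cases h : a = b
    · subst h
      simpa [Matrix.one_apply_eq] using L.Ppow_one_mem (le_of_eq (h0 (β a)))
    · simpa [Matrix.one_apply_ne h] using L.Ppow_zero_mem _
  add_mem' := by
    intro B C hB hC a b
    simpa [Matrix.add_apply] using L.Ppow_add_mem (hB a b) (hC a b)
  neg_mem' := by
    intro B hB a b
    simpa [Matrix.neg_apply] using L.Ppow_neg_mem (hB a b)
  mul_mem' := by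
    intro B C hB hC a b
    rw [Matrix.mul_apply]
    refine Finset.sum_induction _ (· ∈ L.Ppow (m (β a) (β b)))
      (fun x y hx hy => L.Ppow_add_mem hx hy) (L.Ppow_zero_mem _) ?_
    intro c _
    exact L.Ppow_mono (htri (β a) (β c) (β b)) (L.Ppow_mul_mem (hB a c) (hC c b))

/-- The monoid `O^•` of cancellative elements (nonzero reduced norm) of a subring `O`
of a matrix algebra over `D_p`. -/
def matDot {ι : Type} [Fintype ι] [DecidableEq ι] (O : Subring (Matrix ι ι L.D)) :
    Submonoid (Matrix ι ι L.D) where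
  carrier := {B | B ∈ O ∧ L.nrd B ≠ 0}
  one_mem' := ⟨Subring.one_mem O, by rw [L.nrd_one]; exact one_ne_zero⟩
  mul_mem' := by
    intro B C hB hC
    exact ⟨Subring.mul_mem O hB.1 hC.1, by rw [L.nrd_mul]; exact mul_ne_zero hB.2 hC.2⟩

/-- `O` is an `R_p`-order in the algebra `B`: it contains the image of the valuation
ring `R_p = {x | v(x) ≥ 0}`, is finitely generated as an `R_p`-module, and spans `B`
over `K_p`. -/
def IsOrderIn {Kp : Type} [Field Kp] (v : Kp → ℤ) {B : Type} [Ring B] (ψ : Kp →+* B)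
    (O : Subring B) : Prop :=
  (∀ x : Kp, (x = 0 ∨ 0 ≤ v x) → ψ x ∈ O) ∧
  (∃ s : Finset B, ↑s ⊆ (O : Set B) ∧ ∀ b ∈ O, ∃ c : B → Kp,
      (∀ y : B, c y = 0 ∨ 0 ≤ v (c y)) ∧ b = ∑ y ∈ s, ψ (c y) * y) ∧
  (∀ b : B, ∃ x : Kp, x ≠ 0 ∧ ψ x * b ∈ O)

/-- A local order `O ⊆ M_n(D_p)` is tiled if it contains a conjugate of
`Diag(Δ_p, …, Δ_p)`. -/
def IsTiledOrder {n : ℕ} (O : Subring (Matrix (Fin n) (Fin n) L.D)) : Prop :=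
  IsOrderIn L.v (algebraMap L.Kp (Matrix (Fin n) (Fin n) L.D)) O ∧
  ∃ u : (Matrix (Fin n) (Fin n) L.D)ˣ,
    ∀ B : Matrix (Fin n) (Fin n) L.D,
      (∀ i j, (i = j → B i j ∈ L.Delta) ∧ (i ≠ j → B i j = 0)) →
      u.val * B * (u⁻¹).val ∈ O

end LocalCSA

end Paper

namespace Paper

section MonoidFacts
variable {M : Type*} [Monoid M]

lemma hasLen_of_list (l : List M) (hl : ∀ x ∈ l, IsAtomM x) : HasLen l.prod l.length := by
  refine ⟨1, l.get, isUnit_one, fun i => hl _ (List.get_mem _ _), ?_⟩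
  rw [List.ofFn_get, one_mul]

lemma len_prod_bounds (len : M → ℕ) (h1 : len 1 = 0) (hmul : ∀ a b, len (a * b) = len a + len b)
    (C : ℕ) (l : List M) (hlo : ∀ x ∈ l, 1 ≤ len x) (hhi : ∀ x ∈ l, len x ≤ C) :
    l.length ≤ len l.prod ∧ len l.prod ≤ C * l.length := by
  induction l with
  | nil => simp [h1]
  | cons x l ih =>
    have := ih (fun y hy => hlo y (by simp [hy])) (fun y hy => hhi y (by simp [hy]))
    have a1 := hlo x (by simp)
    have a2 := hhi x (by simp)
    rw [List.prod_cons, hmul, List.length_cons]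
    constructor
    · omega
    · nlinarith

lemma elasticity_lt_top_of_len (len : M → ℕ) (hmul : ∀ a b, len (a * b) = len a + len b)
    (hunit : ∀ a, len a = 0 ↔ IsUnit a) (C : ℕ) (hC : ∀ a, IsAtomM a → len a ≤ C) :
    elasticity M < ⊤ := by
  have h1 : len 1 = 0 := (hunit 1).2 isUnit_one
  have key : ∀ (a : M) (k : ℕ), HasLen a k → k ≤ len a ∧ len a ≤ C * k := by
    rintro a k ⟨ε, u, hε, hu, rfl⟩
    have h := len_prod_bounds len h1 hmul C (List.ofFn u) (by
      intro x hx
      obtain ⟨i, rfl⟩ := (List.mem_ofFn' u x).1 hx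
      have := mt (hunit (u i)).1 (hu i).1
      omega) (by
      intro x hx
      obtain ⟨i, rfl⟩ := (List.mem_ofFn' u x).1 hx
      exact hC _ (hu i))
    rw [List.length_ofFn] at h
    rw [hmul, (hunit ε).2 hε, zero_add]
    exact h
  have hb : elasticity M ≤ ((C + 1 : ℕ) : ℝ≥0∞) := by
    refine iSup_le fun a => ?_
    unfold elastOf
    split_ifs with ha
    · exact_mod_cast Nat.le_add_left 1 C
    · by_cases hne : (LenSet a).Nonempty
      · have hmin : minLen a ∈ LenSet a := Nat.sInf_mem hne
        obtain ⟨_, h2⟩ := key a _ hmin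
        have hla : len a ≠ 0 := mt (hunit a).1 ha
        have hpos : minLen a ≠ 0 := by
          intro h
          rw [h] at h2
          omega
        refine ENNReal.div_le_of_le_mul ?_
        refine iSup₂_le fun k hk => ?_
        obtain ⟨h3, _⟩ := key a k hk
        have : k ≤ (C + 1) * minLen a := by nlinarith
        exact_mod_cast this
      · have : supLen a = 0 := by
          unfold supLen
          rw [Set.not_nonempty_iff_eq_empty.1 hne]
          simp
        rw [this]
        simp
  exact lt_of_le_of_lt hb (ENNReal.natCast_lt_top _)

lemma exists_atom_list (len : M → ℕ) (hmul : ∀ a b, len (a * b) = len a + len b)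
    (hunit : ∀ a, len a = 0 ↔ IsUnit a) (a : M) (ha : ¬ IsUnit a) :
    ∃ l : List M, (∀ x ∈ l, IsAtomM x) ∧ 1 ≤ l.length ∧ l.prod = a := by
  induction h : len a using Nat.strong_induction_on generalizing a with
  | _ k ih =>
    by_cases hat : IsAtomM a
    · exact ⟨[a], by simpa using hat, by simp, by simp⟩
    · unfold IsAtomM at hat
      push Not at hat
      obtain ⟨b, c, rfl, hb, hc⟩ := hat ha
      have hb' : len b ≠ 0 := mt (hunit b).1 hb
      have hc' : len c ≠ 0 := mt (hunit c).1 hc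
      have hm := hmul b c
      obtain ⟨l1, h1, h2, h3⟩ := ih (len b) (by omega) b hb rfl
      obtain ⟨l2, h4, h5, h6⟩ := ih (len c) (by omega) c hc rfl
      refine ⟨l1 ++ l2, ?_, by simp; omega, by rw [List.prod_append, h3, h6]⟩
      intro x hx
      rcases List.mem_append.1 hx with hx | hx
      · exact h1 x hx
      · exact h4 x hx

lemma exists_atom_list_pow (len : M → ℕ) (hmul : ∀ a b, len (a * b) = len a + len b)
    (hunit : ∀ a, len a = 0 ↔ IsUnit a) (a b : M) (ha : ¬ IsUnit a) (hb : ¬ IsUnit b) (N : ℕ) :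
    ∃ l : List M, (∀ x ∈ l, IsAtomM x) ∧ N ≤ l.length ∧ l.prod = a ^ N * b := by
  induction N with
  | zero =>
    obtain ⟨l, h1, _, h3⟩ := exists_atom_list len hmul hunit b hb
    exact ⟨l, h1, by simp, by simp [h3]⟩
  | succ N ih =>
    obtain ⟨l1, h1, h2, h3⟩ := exists_atom_list len hmul hunit a ha
    obtain ⟨l2, h4, h5, h6⟩ := ih
    refine ⟨l1 ++ l2, ?_, by simp; omega, by rw [List.prod_append, h3, h6, pow_succ', mul_assoc]⟩
    intro x hx
    rcases List.mem_append.1 hx with hx | hx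
    · exact h1 x hx
    · exact h4 x hx

lemma elasticity_eq_top_of (len : M → ℕ) (hmul : ∀ a b, len (a * b) = len a + len b)
    (hunit : ∀ a, len a = 0 ↔ IsUnit a)
    (h : ∀ N : ℕ, ∃ A B D E : M, IsAtomM A ∧ IsAtomM B ∧ ¬ IsUnit D ∧ ¬ IsUnit E ∧
      A * B = D ^ N * E) : elasticity M = ⊤ := by
  by_contra hne
  obtain ⟨r, hr⟩ := ENNReal.exists_nat_gt hne
  obtain ⟨A, B, D, E, hA, hB, hD, hE, hAB⟩ := h (2 * r + 2)
  obtain ⟨l, h1, h2, h3⟩ := exists_atom_list_pow len hmul hunit D E hD hE (2 * r + 2)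
  have hL2 : 2 ∈ LenSet (A * B) := by
    have := hasLen_of_list [A, B] (by simp [hA, hB])
    simpa [LenSet] using this
  have hLl : l.length ∈ LenSet (A * B) := by
    have := hasLen_of_list l h1
    rw [h3, ← hAB] at this
    exact this
  have hmin : minLen (A * B) ≤ 2 := Nat.sInf_le hL2
  have hnu : ¬ IsUnit (A * B) := by
    have a1 := mt (hunit A).1 hA.1
    have a2 := hmul A B
    rw [← hunit]
    omega
  have hsup : ((2 * r + 2 : ℕ) : ℝ≥0∞) ≤ supLen (A * B) :=
    le_trans (by exact_mod_cast h2) (le_iSup₂ (f := fun k (_ : k ∈ LenSet (A * B)) => (k : ℝ≥0∞))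
      l.length hLl)
  have h5 : elastOf (A * B) ≤ elasticity M := le_iSup (fun a : M => elastOf a) (A * B)
  have h6 : (r : ℝ≥0∞) ≤ elastOf (A * B) := by
    unfold elastOf
    rw [if_neg hnu]
    have : ((2 * r + 2 : ℕ) : ℝ≥0∞) / 2 ≤ supLen (A * B) / (minLen (A * B) : ℝ≥0∞) :=
      ENNReal.div_le_div hsup (by exact_mod_cast hmin)
    refine le_trans ?_ this
    rw [ENNReal.le_div_iff_mul_le (by simp) (by simp)]
    have : r * 2 ≤ 2 * r + 2 := by omega
    exact_mod_cast this
  exact absurd (lt_of_le_of_lt (h6.trans h5) hr) (lt_irrefl _)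

lemma isAtomM_map {N : Type*} [Monoid N] (e : M ≃* N) {a : M} (ha : IsAtomM a) : IsAtomM (e a) := by
  refine ⟨fun h => ha.1 ((MulEquiv.isUnit_map e).1 h), fun b c hbc => ?_⟩
  have := ha.2 (e.symm b) (e.symm c) (by rw [← map_mul, ← hbc, e.symm_apply_apply])
  simpa only [MulEquiv.isUnit_map] using this

lemma hasLen_map {N : Type*} [Monoid N] (e : M ≃* N) {a : M} {k : ℕ} (ha : HasLen a k) :
    HasLen (e a) k := by
  obtain ⟨ε, u, h1, h2, rfl⟩ := ha
  refine ⟨e ε, fun i => e (u i), (MulEquiv.isUnit_map e).2 h1, fun i => isAtomM_map e (h2 i), ?_⟩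
  rw [map_mul, map_list_prod, List.map_ofFn]
  rfl

lemma lenSet_map {N : Type*} [Monoid N] (e : M ≃* N) (a : M) : LenSet (e a) = LenSet a := by
  ext k
  refine ⟨fun h => ?_, fun h => hasLen_map e h⟩
  have := hasLen_map e.symm h
  rw [e.symm_apply_apply] at this
  exact this

lemma elasticity_congr {N : Type*} [Monoid N] (e : M ≃* N) : elasticity M = elasticity N := by
  unfold elasticity
  refine e.toEquiv.iSup_congr fun a => ?_
  have hL := lenSet_map e a
  have hu : IsUnit (e a) ↔ IsUnit a := MulEquiv.isUnit_map e
  by_cases ha : IsUnit a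
  · simp [elastOf, ha]
  · simp [elastOf, supLen, minLen, hL, ha]

end MonoidFacts

lemma hereditary_of_ringEquiv {R S : Type*} [Ring R] [Ring S] (e : R ≃+* S)
    (h : IsHereditaryRing R) : IsHereditaryRing S := by
  intro I
  let J : Submodule Rᵐᵒᵖ R :=
    { carrier := {x | e x ∈ I}
      zero_mem' := by simp
      add_mem' := by
        intro a b ha hb
        simpa using I.add_mem ha hb
      smul_mem' := by
        intro c x hx
        have := I.smul_mem (MulOpposite.op (e c.unop)) hx
        simpa using this }
  have hJ := h J
  let σ : Rᵐᵒᵖ ≃+* Sᵐᵒᵖ := RingEquiv.op e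
  have i1 : RingHomInvPair (σ : Rᵐᵒᵖ →+* Sᵐᵒᵖ) (σ.symm : Sᵐᵒᵖ →+* Rᵐᵒᵖ) :=
    RingHomInvPair.of_ringEquiv σ
  have i2 : RingHomInvPair (σ.symm : Sᵐᵒᵖ →+* Rᵐᵒᵖ) (σ : Rᵐᵒᵖ →+* Sᵐᵒᵖ) :=
    RingHomInvPair.of_ringEquiv σ.symm
  let f : J ≃ₛₗ[(σ : Rᵐᵒᵖ →+* Sᵐᵒᵖ)] I :=
    { toFun := fun x => ⟨e x.1, x.2⟩
      map_add' := by intro x y; ext; simp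
      map_smul' := by
        intro c x
        ext
        simp [σ]
      invFun := fun y => ⟨e.symm y.1, by
        change e (e.symm y.1) ∈ I
        simp⟩
      left_inv := by intro x; ext; simp
      right_inv := by intro x; ext; simp }
  exact Module.Projective.of_equiv f

end Paper

namespace Paper
namespace LocalCSA
variable (L : LocalCSA)

lemma v_one : L.v 1 = 0 := by
  have h := L.v_mul 1 1 one_ne_zero one_ne_zero
  rw [one_mul] at h
  omega

lemma v_pow (x : L.Kp) (hx : x ≠ 0) (k : ℕ) : L.v (x ^ k) = k * L.v x := by
  induction k with
  | zero => simp [L.v_one]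
  | succ k ih =>
    rw [pow_succ, L.v_mul _ _ (pow_ne_zero _ hx) hx, ih]
    push_cast
    ring

lemma v_inv (x : L.Kp) (hx : x ≠ 0) : L.v x⁻¹ = - L.v x := by
  have h := L.v_mul x x⁻¹ hx (inv_ne_zero hx)
  rw [mul_inv_cancel₀ hx, L.v_one] at h
  omega

/-- The valuation ring of `K_p`. -/
def Rp : Subring L.Kp where
  carrier := {x | x = 0 ∨ 0 ≤ L.v x}
  zero_mem' := Or.inl rfl
  one_mem' := Or.inr (by rw [L.v_one])
  add_mem' := by
    intro x y hx hy
    by_cases hx0 : x = 0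
    · subst hx0; simpa using hy
    by_cases hy0 : y = 0
    · subst hy0; simpa using hx
    by_cases hxy : x + y = 0
    · exact Or.inl hxy
    exact Or.inr (le_trans (le_min (hx.resolve_left hx0) (hy.resolve_left hy0))
      (L.v_add x y hx0 hy0 hxy))
  neg_mem' := by
    intro x hx
    rcases hx with rfl | hx
    · exact Or.inl (by simp)
    · exact Or.inr (by rw [L.v_neg]; exact hx)
  mul_mem' := by
    intro x y hx hy
    by_cases hx0 : x = 0
    · exact Or.inl (by simp [hx0])
    by_cases hy0 : y = 0
    · exact Or.inl (by simp [hy0])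
    exact Or.inr (by
      rw [L.v_mul x y hx0 hy0]
      exact add_nonneg (hx.resolve_left hx0) (hy.resolve_left hy0))

lemma mem_Rp {x : L.Kp} : x ∈ L.Rp ↔ (x = 0 ∨ 0 ≤ L.v x) := Iff.rfl

lemma Rp_isUnit_iff (x : L.Rp) (hx : x ≠ 0) : IsUnit x ↔ L.v x.1 = 0 := by
  have hx' : x.1 ≠ 0 := fun h => hx (Subtype.ext h)
  constructor
  · intro h
    obtain ⟨y, hy⟩ := h.exists_right_inv
    have hy1 : x.1 * y.1 = 1 := congrArg Subtype.val hy
    have hy0 : y.1 ≠ 0 := by rintro h0; rw [h0] at hy1; simp at hy1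
    have h1 := L.v_mul x.1 y.1 hx' hy0
    rw [hy1, L.v_one] at h1
    have h2 := (L.mem_Rp.1 x.2).resolve_left hx'
    have h3 := (L.mem_Rp.1 y.2).resolve_left hy0
    omega
  · intro h
    refine IsUnit.of_mul_eq_one ⟨x.1⁻¹, Or.inr (by rw [L.v_inv _ hx', h]; simp)⟩ ?_
    exact Subtype.ext (mul_inv_cancel₀ hx')

lemma Rp_dvr : IsDiscreteValuationRing L.Rp := by
  apply IsDiscreteValuationRing.ofHasUnitMulPowIrreducibleFactorization
  let p : L.Rp := ⟨L.piK, Or.inr (by rw [L.v_piK]; norm_num)⟩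
  have hp0 : p ≠ 0 := fun h => L.piK_ne (congrArg Subtype.val h)
  refine ⟨p, ⟨?_, ?_⟩, ?_⟩
  · rw [L.Rp_isUnit_iff p hp0]
    change L.v L.piK ≠ 0
    rw [L.v_piK]; norm_num
  · intro a b hab
    have ha : a ≠ 0 := by rintro rfl; simp [hp0] at hab
    have hb : b ≠ 0 := by rintro rfl; simp [hp0] at hab
    have ha' : a.1 ≠ 0 := fun h => ha (Subtype.ext h)
    have hb' : b.1 ≠ 0 := fun h => hb (Subtype.ext h)
    rw [L.Rp_isUnit_iff a ha, L.Rp_isUnit_iff b hb]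
    have h1 : L.piK = a.1 * b.1 := congrArg Subtype.val hab
    have h2 := L.v_mul a.1 b.1 ha' hb'
    rw [← h1, L.v_piK] at h2
    have h3 := (L.mem_Rp.1 a.2).resolve_left ha'
    have h4 := (L.mem_Rp.1 b.2).resolve_left hb'
    omega
  · intro x hx
    have hx' : x.1 ≠ 0 := fun h => hx (Subtype.ext h)
    have h3 := (L.mem_Rp.1 x.2).resolve_left hx'
    obtain ⟨k, hk⟩ := Int.eq_ofNat_of_zero_le h3
    have hpk : L.piK ^ k ≠ 0 := pow_ne_zero _ L.piK_ne
    have hv : L.v (x.1 * (L.piK ^ k)⁻¹) = 0 := by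
      rw [L.v_mul _ _ hx' (inv_ne_zero hpk), L.v_inv _ hpk, L.v_pow _ L.piK_ne, L.v_piK, hk]
      simp
    have hne : x.1 * (L.piK ^ k)⁻¹ ≠ 0 := mul_ne_zero hx' (inv_ne_zero hpk)
    let y : L.Rp := ⟨x.1 * (L.piK ^ k)⁻¹, Or.inr hv.ge⟩
    have hy : IsUnit y := (L.Rp_isUnit_iff y (fun h => hne (congrArg Subtype.val h))).2 hv
    refine ⟨k, hy.unit, ?_⟩
    apply Subtype.ext
    change L.piK ^ k * (x.1 * (L.piK ^ k)⁻¹) = x.1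
    field_simp

/-- The additive length function on `O^•` for an order `O`: the valuation of the
norm of left multiplication on the free `R_p`-module `O`. -/
lemma exists_len {n : ℕ} (O : Subring (Matrix (Fin n) (Fin n) L.D))
    (hO : IsOrderIn L.v (algebraMap L.Kp (Matrix (Fin n) (Fin n) L.D)) O) :
    ∃ len : ↥(L.matDot O) → ℕ, (∀ a b, len (a * b) = len a + len b) ∧
      ∀ a, len a = 0 ↔ IsUnit a := by
  obtain ⟨hR, ⟨s, hsO, hs⟩, hspan⟩ := hO
  let ψ := algebraMap L.Kp (Matrix (Fin n) (Fin n) L.D)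
  let φ : L.Rp →+* O := (ψ.comp L.Rp.subtype).codRestrict O (fun x => hR x.1 x.2)
  have hφ : ∀ x : L.Rp, (φ x : Matrix (Fin n) (Fin n) L.D) = ψ x.1 := fun x => rfl
  let : Algebra L.Rp O := RingHom.toAlgebra' φ (by
    intro c x
    apply Subtype.ext
    exact Algebra.commutes c.1 x.1)
  have hsm : ∀ (c : L.Rp) (x : O), ((c • x : O) : Matrix (Fin n) (Fin n) L.D) = ψ c.1 * x.1 := by
    intro c x
    rw [Algebra.smul_def]
    rfl
  have := L.Rp_dvr
  have : Module.Finite L.Rp O := by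
    classical
    refine ⟨⟨s.attach.image (fun y => ⟨y.1, hsO y.2⟩), ?_⟩⟩
    rw [eq_top_iff]
    rintro ⟨b, hb⟩ -
    obtain ⟨c, hc, hbc⟩ := hs b hb
    have : (⟨b, hb⟩ : O) = ∑ y ∈ s.attach, (⟨c y.1, hc y.1⟩ : L.Rp) • (⟨y.1, hsO y.2⟩ : O) := by
      apply Subtype.ext
      rw [AddSubmonoidClass.coe_finsetSum]
      simp only [hsm]
      rw [hbc]
      exact (Finset.sum_attach s (fun y => ψ (c y) * y)).symm
    rw [this]
    refine Submodule.sum_mem _ fun y hy => Submodule.smul_mem _ _ (Submodule.subset_span ?_)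
    simp only [Finset.coe_image, Set.mem_image]
    exact ⟨y, by simp, rfl⟩
  have : Module.IsTorsionFree L.Rp O := by
    rw [Module.isTorsionFree_iff_smul_eq_zero]
    intro c x h
    by_cases hc : c = 0
    · exact Or.inl hc
    · right
      have h1 : ψ c.1 * x.1 = 0 := by rw [← hsm, h]; rfl
      have hc' : c.1 ≠ 0 := fun h => hc (Subtype.ext h)
      have h2 : ψ (c.1⁻¹) * (ψ c.1 * x.1) = 0 := by rw [h1, mul_zero]
      rw [← mul_assoc, ← map_mul, inv_mul_cancel₀ hc', map_one, one_mul] at h2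
      exact Subtype.ext h2
  have : Module.Free L.Rp O := inferInstance
  have hnorm : ∀ a : ↥(L.matDot O), Algebra.norm L.Rp (⟨a.1, a.2.1⟩ : O) ≠ 0 := by
    intro a h0
    have hu : IsUnit a.1 := (L.nrd_unit a.1).1 a.2.2
    obtain ⟨y, hy⟩ := hu.exists_right_inv
    obtain ⟨k, hk0, hk⟩ := hspan y
    obtain ⟨k', hk0', hkR, hk'⟩ : ∃ k' : L.Kp, k' ≠ 0 ∧ k' ∈ L.Rp ∧ ψ k' * y ∈ O := by
      by_cases hv : 0 ≤ L.v k
      · exact ⟨k, hk0, Or.inr hv, hk⟩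
      · obtain ⟨t, ht⟩ := Int.eq_ofNat_of_zero_le (show 0 ≤ - L.v k by omega)
        have hpt : L.piK ^ t ≠ 0 := pow_ne_zero _ L.piK_ne
        have hvt : L.v (L.piK ^ t) = t := by rw [L.v_pow _ L.piK_ne, L.v_piK]; simp
        refine ⟨L.piK ^ t * k, mul_ne_zero hpt hk0, Or.inr ?_, ?_⟩
        · rw [L.v_mul _ _ hpt hk0, hvt]; omega
        · rw [map_mul, mul_assoc]
          exact O.mul_mem (hR _ (Or.inr (by rw [hvt]; omega))) hk
    have h1 : (⟨a.1, a.2.1⟩ : O) * ⟨ψ k' * y, hk'⟩ = algebraMap L.Rp O ⟨k', hkR⟩ := by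
      apply Subtype.ext
      change a.1 * (ψ k' * y) = ψ k'
      rw [← mul_assoc, ← Algebra.commutes, mul_assoc, hy, mul_one]
    have h2 := congrArg (Algebra.norm L.Rp) h1
    rw [map_mul, h0, zero_mul, Algebra.norm_algebraMap] at h2
    exact pow_ne_zero _ (fun h => hk0' (congrArg Subtype.val h)) h2.symm
  have hnorm' : ∀ a : ↥(L.matDot O), (Algebra.norm L.Rp (⟨a.1, a.2.1⟩ : O)).1 ≠ 0 :=
    fun a h => hnorm a (Subtype.ext h)
  have hpos : ∀ a : ↥(L.matDot O), 0 ≤ L.v (Algebra.norm L.Rp (⟨a.1, a.2.1⟩ : O)).1 :=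
    fun a => (L.mem_Rp.1 (Algebra.norm L.Rp (⟨a.1, a.2.1⟩ : O)).2).resolve_left (hnorm' a)
  refine ⟨fun a => (L.v (Algebra.norm L.Rp (⟨a.1, a.2.1⟩ : O)).1).toNat, ?_, ?_⟩
  · intro a b
    have h1 : (⟨(a * b).1, (a * b).2.1⟩ : O) = ⟨a.1, a.2.1⟩ * ⟨b.1, b.2.1⟩ := rfl
    have h2 := L.v_mul _ _ (hnorm' a) (hnorm' b)
    have h3 := hpos a
    have h4 := hpos b
    simp only [h1, map_mul, Subring.coe_mul, h2]
    omega
  · intro a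
    have h3 := hpos a
    constructor
    · intro h
      have hv : L.v (Algebra.norm L.Rp (⟨a.1, a.2.1⟩ : O)).1 = 0 := by
        have := Int.toNat_eq_zero.1 h
        omega
      have hunit := (L.Rp_isUnit_iff _ (hnorm a)).2 hv
      rw [Algebra.norm_apply] at hunit
      let f := LinearMap.equivOfIsUnitDet hunit
      have hf : ∀ x : O, f x = ⟨a.1, a.2.1⟩ * x := by
        intro x
        simp [f]
      obtain ⟨c, hc⟩ := f.surjective 1
      rw [hf] at hc
      have hc1 : a.1 * c.1 = 1 := congrArg Subtype.val hc
      have hu : IsUnit a.1 := (L.nrd_unit a.1).1 a.2.2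
      have hc2 : c.1 * a.1 = 1 := by
        obtain ⟨y, hy⟩ := hu.exists_left_inv
        have : y = c.1 := left_inv_eq_right_inv hy hc1
        rw [← this]; exact hy
      have hcn : L.nrd c.1 ≠ 0 := (L.nrd_unit c.1).2 ⟨⟨c.1, a.1, hc2, hc1⟩, rfl⟩
      exact ⟨⟨a, ⟨c.1, c.2, hcn⟩, Subtype.ext hc1, Subtype.ext hc2⟩, rfl⟩
    · intro h
      obtain ⟨b, hb⟩ := h.exists_right_inv
      have h1 : (⟨a.1, a.2.1⟩ : O) * ⟨b.1, b.2.1⟩ = 1 := by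
        have hb' : a.1 * b.1 = 1 := congrArg Subtype.val hb
        exact Subtype.ext hb'
      have h2 := congrArg (Algebra.norm L.Rp) h1
      rw [map_mul, map_one] at h2
      have hu := IsUnit.of_mul_eq_one _ h2
      have := (L.Rp_isUnit_iff _ (hnorm a)).1 hu
      exact Int.toNat_eq_zero.2 this.le

end LocalCSA
end Paper

namespace Paper
namespace LocalCSA
variable (L : LocalCSA)

lemma w_inv (x : L.D) (hx : x ≠ 0) : L.w x⁻¹ = - L.w x := by
  have h := L.w_mul x x⁻¹ hx (inv_ne_zero hx)
  rw [mul_inv_cancel₀ hx, L.w_one] at h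
  omega

lemma w_pow (x : L.D) (hx : x ≠ 0) (k : ℕ) : L.w (x ^ k) = k * L.w x := by
  induction k with
  | zero => simp [L.w_one]
  | succ k ih =>
    rw [pow_succ, L.w_mul _ _ (pow_ne_zero _ hx) hx, ih]
    push_cast
    ring

lemma w_zpow (k : ℤ) : L.w (L.ϖ ^ k) = k := by
  rcases k with k | k
  · rw [Int.ofNat_eq_natCast, zpow_natCast, L.w_pow _ L.ϖ_ne, L.w_ϖ]; simp
  · rw [zpow_negSucc, L.w_inv _ (pow_ne_zero _ L.ϖ_ne), L.w_pow _ L.ϖ_ne, L.w_ϖ]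
    simp [Int.negSucc_eq]

lemma zpow_mem (k : ℤ) : L.ϖ ^ k ∈ L.Ppow k := Or.inr (L.w_zpow k).ge

lemma mem_Ppow_of_ne {x : L.D} (hx : x ≠ 0) {k : ℤ} : x ∈ L.Ppow k ↔ k ≤ L.w x :=
  ⟨fun h => h.resolve_left hx, Or.inr⟩

lemma not_mem_Ppow {x : L.D} {k : ℤ} : x ∉ L.Ppow k ↔ x ≠ 0 ∧ L.w x < k := by
  constructor
  · intro h
    have hx : x ≠ 0 := fun h0 => h (Or.inl h0)
    rw [L.mem_Ppow_of_ne hx] at h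
    exact ⟨hx, not_le.1 h⟩
  · rintro ⟨hx, h⟩
    rw [L.mem_Ppow_of_ne hx]
    omega

lemma Ppow_sum_mem {ι : Type*} (s : Finset ι) (f : ι → L.D) (k : ℤ)
    (h : ∀ i ∈ s, f i ∈ L.Ppow k) : ∑ i ∈ s, f i ∈ L.Ppow k :=
  Finset.sum_induction _ (· ∈ L.Ppow k) (fun _ _ hx hy => L.Ppow_add_mem hx hy)
    (L.Ppow_zero_mem _) h

lemma Ppow_sub_mem {m : ℤ} {x y : L.D} (hx : x ∈ L.Ppow m) (hy : y ∈ L.Ppow m) :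
    x - y ∈ L.Ppow m := by
  rw [sub_eq_add_neg]; exact L.Ppow_add_mem hx (L.Ppow_neg_mem hy)

lemma algebraMap_mem (x : L.Kp) (hx : x = 0 ∨ 0 ≤ L.v x) : algebraMap L.Kp L.D x ∈ L.Ppow 0 := by
  by_cases h0 : x = 0
  · left; rw [h0, map_zero]
  · right
    rw [L.w_algebraMap x h0]
    exact mul_nonneg (by positivity) (hx.resolve_left h0)

/-- Every tiled order is conjugate to a standard one. -/
lemma exists_std {n : ℕ} (O : Subring (Matrix (Fin n) (Fin n) L.D)) (hO : L.IsTiledOrder O) :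
    ∃ (u : (Matrix (Fin n) (Fin n) L.D)ˣ) (m : Fin n → Fin n → ℤ), (∀ i, m i i = 0) ∧
      (∀ i j k, m i k ≤ m i j + m j k) ∧
      ∀ B : Matrix (Fin n) (Fin n) L.D,
        u.val * B * (u⁻¹).val ∈ O ↔ ∀ a b, B a b ∈ L.Ppow (m a b) := by
  obtain ⟨⟨hR, ⟨s, hsO, hs⟩, hspan⟩, u, hu⟩ := hO
  let T : Subring (Matrix (Fin n) (Fin n) L.D) :=
    O.comap (MulSemiringAction.toRingHom (ConjAct (Matrix (Fin n) (Fin n) L.D)ˣ) _ (ConjAct.toConjAct u))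
  have hT : ∀ B, B ∈ T ↔ u.val * B * (u⁻¹).val ∈ O := fun B => Iff.rfl
  have hd : ∀ (i : Fin n) (x : L.D), x ∈ L.Ppow 0 → Matrix.single i i x ∈ T := by
    intro i x hx
    rw [hT]
    refine hu _ fun a b => ⟨?_, ?_⟩
    · rintro rfl
      by_cases h : i = a
      · subst h; rw [Matrix.single_apply_same]; exact hx
      · rw [Matrix.single_apply_of_ne _ _ _ _ _ (by tauto)]; exact Or.inl rfl
    · intro hab
      exact Matrix.single_apply_of_ne _ _ _ _ _ (by rintro ⟨rfl, rfl⟩; exact hab rfl)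
  have hone : ∀ i : Fin n, Matrix.single i i (1 : L.D) ∈ T :=
    fun i => hd i 1 (L.Ppow_one_mem le_rfl)
  have hentry : ∀ B ∈ T, ∀ i j, Matrix.single i j (B i j) ∈ T := by
    intro B hB i j
    have h := T.mul_mem (T.mul_mem (hone i) hB) (hone j)
    rw [Matrix.single_mul_mul_single] at h
    simpa using h
  -- nonzero
  have hnz : ∀ i j, ∃ x : L.D, x ≠ 0 ∧ Matrix.single i j x ∈ T := by
    intro i j
    obtain ⟨k, hk0, hk⟩ := hspan (u.val * Matrix.single i j 1 * (u⁻¹).val)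
    refine ⟨algebraMap L.Kp L.D k, by simpa using hk0, ?_⟩
    rw [hT]
    convert hk using 1
    rw [← Algebra.smul_def, ← Matrix.smul_mul, ← Matrix.mul_smul, Matrix.smul_single,
      Algebra.algebraMap_eq_smul_one]
  -- bounded
  have hbd : ∀ i j, ∃ N : ℤ, ∀ x, Matrix.single i j x ∈ T → x ∈ L.Ppow N := by
    intro i j
    have hfin : ∃ N : ℤ, ∀ y ∈ s, ((u⁻¹).val * y * u.val) i j ∈ L.Ppow N := by
      obtain ⟨N, hN⟩ := (s.image (fun y => L.w (((u⁻¹).val * y * u.val) i j))).bddBelow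
      refine ⟨N, fun y hy => Or.inr (hN ?_)⟩
      exact Finset.mem_coe.2 (Finset.mem_image_of_mem _ hy)
    obtain ⟨N, hN⟩ := hfin
    refine ⟨N, fun x hx => ?_⟩
    rw [hT] at hx
    obtain ⟨c, hc, hsum⟩ := hs _ hx
    have h1 : Matrix.single i j x = ∑ y ∈ s, c y • ((u⁻¹).val * y * u.val) := by
      have : Matrix.single i j x = (u⁻¹).val * (u.val * Matrix.single i j x * (u⁻¹).val) * u.val := by
        simp [mul_assoc]
      rw [this, hsum, Finset.mul_sum, Finset.sum_mul]
      refine Finset.sum_congr rfl fun y _ => ?_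
      rw [← Algebra.smul_def, Matrix.mul_smul, Matrix.smul_mul]
    have h2 := congrFun (congrFun h1 i) j
    rw [Matrix.single_apply_same, Matrix.sum_apply] at h2
    rw [h2]
    refine L.Ppow_sum_mem _ _ _ fun y hy => ?_
    rw [Matrix.smul_apply, Algebra.smul_def]
    have := L.Ppow_mul_mem (L.algebraMap_mem (c y) (hc y)) (hN y hy)
    rwa [zero_add] at this
  have hm : ∀ i j, ∃ k : ℤ, ∀ x, Matrix.single i j x ∈ T ↔ x ∈ L.Ppow k := by
    intro i j
    obtain ⟨N, hN⟩ := hbd i j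
    obtain ⟨x0, hx0, hx0T⟩ := hnz i j
    obtain ⟨k, ⟨z, hz0, hzT, hzk⟩, hmin⟩ := Int.exists_least_of_bdd
      (P := fun k => ∃ z : L.D, z ≠ 0 ∧ Matrix.single i j z ∈ T ∧ L.w z = k)
      ⟨N, by
        rintro k ⟨z, hz0, hzT, rfl⟩
        exact (L.mem_Ppow_of_ne hz0).1 (hN z hzT)⟩ ⟨_, x0, hx0, hx0T, rfl⟩
    refine ⟨k, fun x => ⟨fun hx => ?_, fun hx => ?_⟩⟩
    · by_cases hx0 : x = 0
      · exact Or.inl hx0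
      · exact Or.inr (hmin _ ⟨x, hx0, hx, rfl⟩)
    · by_cases hx0 : x = 0
      · rw [hx0]; simp [T.zero_mem]
      · have hw := (L.mem_Ppow_of_ne hx0).1 hx
        have h1 : x * z⁻¹ ∈ L.Ppow 0 := by
          right
          rw [L.w_mul _ _ hx0 (inv_ne_zero hz0), L.w_inv _ hz0]
          omega
        have h2 := T.mul_mem (hd i _ h1) hzT
        rw [Matrix.single_mul_single_same, mul_assoc, inv_mul_cancel₀ hz0, mul_one] at h2
        exact h2
  choose m hm using hm
  refine ⟨u, m, ?_, ?_, ?_⟩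
  · intro i
    apply le_antisymm
    · have h1 := (hm i i 1).1 (hone i)
      rw [L.mem_Ppow_of_ne one_ne_zero, L.w_one] at h1
      exact h1
    · have h1 : L.ϖ ^ (m i i) * L.ϖ ^ (m i i) ∈ L.Ppow (m i i) := by
        rw [← hm, ← Matrix.single_mul_single_same (j := i)]
        exact T.mul_mem ((hm _ _ _).2 (L.zpow_mem _)) ((hm _ _ _).2 (L.zpow_mem _))
      rw [← zpow_add₀ L.ϖ_ne, L.mem_Ppow_of_ne (zpow_ne_zero _ L.ϖ_ne), L.w_zpow] at h1
      omega
  · intro i j k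
    have h1 : L.ϖ ^ (m i j) * L.ϖ ^ (m j k) ∈ L.Ppow (m i k) := by
      rw [← hm, ← Matrix.single_mul_single_same (j := j)]
      exact T.mul_mem ((hm _ _ _).2 (L.zpow_mem _)) ((hm _ _ _).2 (L.zpow_mem _))
    rw [← zpow_add₀ L.ϖ_ne, L.mem_Ppow_of_ne (zpow_ne_zero _ L.ϖ_ne), L.w_zpow] at h1
    exact h1
  · intro B
    rw [← hT]
    constructor
    · intro hB a b
      exact (hm a b _).1 (hentry B hB a b)
    · intro hB
      rw [Matrix.matrix_eq_sum_single B]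
      exact T.sum_mem fun i _ => T.sum_mem fun j _ => (hm i j _).2 (hB i j)

end LocalCSA
end Paper

namespace Paper
namespace LocalCSA
variable (L : LocalCSA) {n : ℕ} (m : Fin n → Fin n → ℤ)

/-- Membership in the standard order with exponent matrix `m`. -/
def InT (B : Matrix (Fin n) (Fin n) L.D) : Prop := ∀ a b, B a b ∈ L.Ppow (m a b)

/-- Being a unit of the standard order with exponent matrix `m`. -/
def IsUT (B : Matrix (Fin n) (Fin n) L.D) : Prop :=
  ∃ B' : Matrix (Fin n) (Fin n) L.D, L.InT m B ∧ L.InT m B' ∧ B * B' = 1 ∧ B' * B = 1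

variable {L m}

lemma InT.mul (htri : ∀ i j k, m i k ≤ m i j + m j k) {B C : Matrix (Fin n) (Fin n) L.D}
    (hB : L.InT m B) (hC : L.InT m C) : L.InT m (B * C) := by
  intro a b
  rw [Matrix.mul_apply]
  exact L.Ppow_sum_mem _ _ _ fun c _ =>
    L.Ppow_mono (htri a c b) (L.Ppow_mul_mem (hB a c) (hC c b))

lemma InT.one (h0 : ∀ i, m i i = 0) : L.InT m (1 : Matrix (Fin n) (Fin n) L.D) := by
  intro a b
  by_cases h : a = b
  · subst h
    rw [Matrix.one_apply_eq]
    exact L.Ppow_one_mem (h0 a).le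
  · rw [Matrix.one_apply_ne h]
    exact L.Ppow_zero_mem _

lemma IsUT.inT {B : Matrix (Fin n) (Fin n) L.D} (h : L.IsUT m B) : L.InT m B := h.choose_spec.1

lemma IsUT.isUnit {B : Matrix (Fin n) (Fin n) L.D} (h : L.IsUT m B) : IsUnit B := by
  obtain ⟨B', _, _, h1, h2⟩ := h
  exact ⟨⟨B, B', h1, h2⟩, rfl⟩

lemma IsUT.mul (htri : ∀ i j k, m i k ≤ m i j + m j k) {B C : Matrix (Fin n) (Fin n) L.D}
    (hB : L.IsUT m B) (hC : L.IsUT m C) : L.IsUT m (B * C) := by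
  obtain ⟨B', h1, h2, h3, h4⟩ := hB
  obtain ⟨C', h5, h6, h7, h8⟩ := hC
  refine ⟨C' * B', h1.mul htri h5, h6.mul htri h2, ?_, ?_⟩
  · rw [mul_assoc, ← mul_assoc C, h7, one_mul, h3]
  · rw [mul_assoc, ← mul_assoc B', h4, one_mul, h8]

lemma IsUT.one (h0 : ∀ i, m i i = 0) : L.IsUT m (1 : Matrix (Fin n) (Fin n) L.D) :=
  ⟨1, InT.one h0, InT.one h0, by simp, by simp⟩

lemma IsUT.exists_inv {B : Matrix (Fin n) (Fin n) L.D} (h : L.IsUT m B) :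
    ∃ B', L.IsUT m B' ∧ B * B' = 1 ∧ B' * B = 1 := by
  obtain ⟨B', h1, h2, h3, h4⟩ := h
  exact ⟨B', ⟨B, h2, h1, h4, h3⟩, h3, h4⟩

lemma ne_zero_of_not_mem {x : L.D} {k : ℤ} (h : x ∉ L.Ppow k) : x ≠ 0 := fun h0 => h (Or.inl h0)

lemma inv_mem {x : L.D} (h : x ∉ L.Ppow 1) : x⁻¹ ∈ L.Ppow 0 := by
  obtain ⟨h1, h2⟩ := L.not_mem_Ppow.1 h
  right
  rw [L.w_inv _ h1]; omega

lemma mul_not_mem {x y : L.D} (hx : x ∉ L.Ppow 1) (hy : y ∉ L.Ppow 1) : x * y ∉ L.Ppow 1 := by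
  obtain ⟨h1, h2⟩ := L.not_mem_Ppow.1 hx
  obtain ⟨h3, h4⟩ := L.not_mem_Ppow.1 hy
  rw [L.not_mem_Ppow, L.w_mul _ _ h1 h3]
  exact ⟨mul_ne_zero h1 h3, by omega⟩

/-- The identity matrix with row `l` replaced by `r`. -/
lemma mul_updateRow_apply (X : Matrix (Fin n) (Fin n) L.D) (l : Fin n) (r : Fin n → L.D)
    (a b : Fin n) : (X * Matrix.updateRow 1 l r) a b = (if b = l then 0 else X a b) + X a l * r b := by
  rw [Matrix.mul_apply, ← Finset.sum_erase_add _ _ (Finset.mem_univ l), Matrix.updateRow_self]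
  congr 1
  have : ∀ k ∈ Finset.univ.erase l, X a k * Matrix.updateRow (1 : Matrix (Fin n) (Fin n) L.D) l r k b
      = if k = b then X a b else 0 := by
    intro k hk
    rw [Matrix.updateRow_ne (Finset.ne_of_mem_erase hk), Matrix.one_apply]
    split_ifs with h
    · rw [h, mul_one]
    · rw [mul_zero]
  rw [Finset.sum_congr rfl this, Finset.sum_ite_eq']
  by_cases h : b = l <;> simp [h]

lemma inT_updateRow (h0 : ∀ i, m i i = 0) (l : Fin n) (r : Fin n → L.D)
    (hr : ∀ k, r k ∈ L.Ppow (m l k)) : L.InT m (Matrix.updateRow 1 l r) := by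
  intro a b
  by_cases h : a = l
  · subst h; rw [Matrix.updateRow_self]; exact hr b
  · rw [Matrix.updateRow_ne h]; exact InT.one h0 a b

lemma updateRow_mul_updateRow (l : Fin n) (r r' : Fin n → L.D)
    (h1 : r l * r' l = 1) (h2 : ∀ k, k ≠ l → r k + r l * r' k = 0) :
    Matrix.updateRow (1 : Matrix (Fin n) (Fin n) L.D) l r * Matrix.updateRow 1 l r' = 1 := by
  ext a b
  rw [mul_updateRow_apply]
  by_cases ha : a = l
  · subst ha
    rw [Matrix.updateRow_self]
    by_cases hb : b = a
    · subst hb; simp [h1]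
    · rw [if_neg hb, h2 b hb, Matrix.one_apply_ne (Ne.symm hb)]
  · rw [Matrix.updateRow_ne ha, Matrix.one_apply_ne ha, zero_mul, add_zero]
    split_ifs with h
    · rw [Matrix.one_apply_ne]; rw [h]; exact ha
    · rfl

lemma isUT_updateRow (h0 : ∀ i, m i i = 0) (l : Fin n) (r : Fin n → L.D)
    (hr : ∀ k, r k ∈ L.Ppow (m l k)) (hl : r l ∉ L.Ppow 1) :
    L.IsUT m (Matrix.updateRow 1 l r) := by
  have hne := ne_zero_of_not_mem hl
  refine ⟨Matrix.updateRow 1 l (fun k => if k = l then (r l)⁻¹ else -((r l)⁻¹ * r k)),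
    inT_updateRow h0 l r hr, inT_updateRow h0 l _ ?_, updateRow_mul_updateRow l _ _ ?_ ?_,
    updateRow_mul_updateRow l _ _ ?_ ?_⟩
  · intro k
    by_cases hk : k = l
    · subst hk
      simp only [if_true]
      rw [h0]; exact inv_mem hl
    · rw [if_neg hk]
      have := L.Ppow_mul_mem (inv_mem hl) (hr k)
      rw [zero_add] at this
      exact L.Ppow_neg_mem this
  · simp [hne]
  · intro k hk
    simp [hk, hne]
  · simp [hne]
  · intro k hk
    simp [hk]

/-- Reduce a factor so that given rows become unit rows. -/
lemma exists_reduce (h0 : ∀ i, m i i = 0) (htri : ∀ i j k, m i k ≤ m i j + m j k)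
    (B C : Matrix (Fin n) (Fin n) L.D) (hB : L.InT m B) (hC : L.InT m C) (S : Finset (Fin n))
    (hS : ∀ l ∈ S, ∀ k, (B * C) l k = (1 : Matrix (Fin n) (Fin n) L.D) l k) :
    ∃ U, L.IsUT m U ∧ ∀ l ∈ S, ∀ k, (B * U) l k = (1 : Matrix (Fin n) (Fin n) L.D) l k := by
  classical
  induction S using Finset.induction_on with
  | empty => exact ⟨1, IsUT.one h0, by simp⟩
  | insert l S hlS ih =>
    obtain ⟨U, hU, hBU⟩ := ih (fun l' hl' => hS l' (Finset.mem_insert_of_mem hl'))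
    obtain ⟨V, hV, hUV, hVU⟩ := hU.exists_inv
    -- the new pair
    set X := B * U with hX
    set Y := V * C with hY
    have hXY : X * Y = B * C := by
      rw [hX, hY, mul_assoc, ← mul_assoc U, hUV, one_mul]
    have hXT : L.InT m X := hB.mul htri hU.inT
    have hYT : L.InT m Y := hV.inT.mul htri hC
    have hYrow : ∀ l' ∈ S, ∀ k, Y l' k = (1 : Matrix (Fin n) (Fin n) L.D) l' k := by
      intro l' hl' k
      rw [← hS l' (Finset.mem_insert_of_mem hl') k, ← hXY, Matrix.mul_apply,
        Finset.sum_eq_single l']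
      · rw [hBU l' hl', Matrix.one_apply_eq, one_mul]
      · intro b _ hb
        rw [hBU l' hl', Matrix.one_apply_ne (Ne.symm hb), zero_mul]
      · intro h; exact absurd (Finset.mem_univ _) h
    -- step 1: make the diagonal entry a unit
    have step1 : ∃ E, L.IsUT m E ∧ (X * E) l l ∉ L.Ppow 1 ∧
        ∀ l' ∈ S, ∀ k, (X * E) l' k = (1 : Matrix (Fin n) (Fin n) L.D) l' k := by
      by_cases hll : X l l ∈ L.Ppow 1
      · have hex : ∃ k, X l k * Y k l ∉ L.Ppow 1 := by
          by_contra hcon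
          push Not at hcon
          have h1 : (X * Y) l l ∈ L.Ppow 1 := by
            rw [Matrix.mul_apply]
            exact L.Ppow_sum_mem _ _ _ fun k _ => hcon k
          rw [hXY, hS l (Finset.mem_insert_self _ _), Matrix.one_apply_eq,
            L.mem_Ppow_of_ne one_ne_zero, L.w_one] at h1
          omega
        obtain ⟨k, hk⟩ := hex
        have hkl : k ≠ l := by
          rintro rfl
          apply hk
          have h2 : Y k k ∈ L.Ppow 0 := by have := hYT k k; rwa [h0] at this
          have := L.Ppow_mul_mem hll h2
          simpa using this
        have hkS : k ∉ S := by
          intro h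
          apply hk
          rw [hYrow k h, Matrix.one_apply_ne hkl, mul_zero]
          exact Or.inl rfl
        refine ⟨Matrix.updateRow 1 k (fun b => if b = l then Y k l else if b = k then 1 else 0),
          isUT_updateRow h0 k _ ?_ ?_, ?_, ?_⟩
        · intro b
          by_cases hb : b = l
          · rw [if_pos hb, hb]; exact hYT k l
          · rw [if_neg hb]
            split_ifs with hbk
            · rw [hbk, h0]; exact L.Ppow_one_mem le_rfl
            · exact Or.inl rfl
        · rw [if_neg hkl, if_pos rfl, L.mem_Ppow_of_ne one_ne_zero, L.w_one]; omega
        · rw [mul_updateRow_apply, if_neg (Ne.symm hkl), if_pos rfl]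
          intro h
          apply hk
          have := L.Ppow_sub_mem h hll
          rwa [add_sub_cancel_left] at this
        · intro l' hl' b
          have hl'k : l' ≠ k := by rintro rfl; exact hkS hl'
          rw [mul_updateRow_apply, hBU l' hl' k, Matrix.one_apply_ne hl'k, zero_mul, add_zero]
          split_ifs with h
          · rw [h, Matrix.one_apply_ne hl'k]
          · exact hBU l' hl' b
      · exact ⟨1, IsUT.one h0, by rwa [mul_one], by rw [mul_one]; exact hBU⟩
    obtain ⟨E, hE, hEl, hES⟩ := step1
    set Z := X * E with hZ
    have hZT : L.InT m Z := hXT.mul htri hE.inT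
    have hRU : L.IsUT m (Matrix.updateRow 1 l (Z l)) := isUT_updateRow h0 l _ (hZT l) hEl
    obtain ⟨R', hR', hRR', hR'R⟩ := hRU.exists_inv
    refine ⟨U * E * R', (hU.mul htri hE).mul htri hR', ?_⟩
    have hall : B * (U * E * R') = Z * R' := by rw [hZ, hX]; simp only [mul_assoc]
    rw [hall]
    -- rows of `Z` that equal rows of `R` become unit rows
    have hrow : ∀ a, (∀ k, Z a k = Matrix.updateRow (1 : Matrix (Fin n) (Fin n) L.D) l (Z l) a k) →
        ∀ k, (Z * R') a k = (1 : Matrix (Fin n) (Fin n) L.D) a k := by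
      intro a ha k
      rw [← hRR', Matrix.mul_apply, Matrix.mul_apply]
      exact Finset.sum_congr rfl fun b _ => by rw [ha b]
    intro l' hl'
    apply hrow
    intro k
    rcases Finset.mem_insert.1 hl' with rfl | h
    · rw [Matrix.updateRow_self]
    · rw [Matrix.updateRow_ne (by rintro rfl; exact hlS h), hES l' h]

/-- A matrix with unit rows outside `{i, j}` and unit diagonal entries is a unit. -/
lemma isUT_of_two (h0 : ∀ i, m i i = 0) (htri : ∀ i j k, m i k ≤ m i j + m j k) (i j : Fin n)
    (hij : i ≠ j) (hm : 1 ≤ m i j + m j i) (B : Matrix (Fin n) (Fin n) L.D) (hB : L.InT m B)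
    (hrow : ∀ l, l ≠ i → l ≠ j → ∀ k, B l k = (1 : Matrix (Fin n) (Fin n) L.D) l k)
    (hi : B i i ∉ L.Ppow 1) (hj : B j j ∉ L.Ppow 1) : L.IsUT m B := by
  have hR := isUT_updateRow h0 i (B i) (hB i) hi
  obtain ⟨R', hR', hRR', hR'R⟩ := hR.exists_inv
  set Z := B * R' with hZ
  have hBZ : B = Z * Matrix.updateRow 1 i (B i) := by rw [hZ, mul_assoc, hR'R, mul_one]
  have hZT : L.InT m Z := hB.mul htri hR'.inT
  have hZrow : ∀ l, l ≠ j → ∀ k, Z l k = (1 : Matrix (Fin n) (Fin n) L.D) l k := by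
    intro l hl k
    rw [← hRR', Matrix.mul_apply, hZ, Matrix.mul_apply]
    refine Finset.sum_congr rfl fun b _ => ?_
    congr 1
    by_cases hli : l = i
    · rw [hli, Matrix.updateRow_self]
    · rw [Matrix.updateRow_ne hli, hrow l hli hl]
  have hZj : Z j j ∉ L.Ppow 1 := by
    intro h
    apply hj
    rw [hBZ, mul_updateRow_apply, if_neg (Ne.symm hij)]
    refine L.Ppow_add_mem h ?_
    exact L.Ppow_mono (by omega) (L.Ppow_mul_mem (hZT j i) (hB i j))
  have hZ' : Z = Matrix.updateRow 1 j (Z j) := by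
    ext a b
    by_cases ha : a = j
    · rw [ha, Matrix.updateRow_self]
    · rw [Matrix.updateRow_ne ha, hZrow a ha]
  rw [hBZ]
  refine IsUT.mul htri ?_ hR
  rw [hZ']
  exact isUT_updateRow h0 j _ (hZT j) hZj

/-- The key irreducibility criterion. -/
lemma atom_criterion (h0 : ∀ i, m i i = 0) (htri : ∀ i j k, m i k ≤ m i j + m j k) (i j : Fin n)
    (hij : i ≠ j) (hm : 1 ≤ m i j + m j i) (A : Matrix (Fin n) (Fin n) L.D)
    (hrow : ∀ l, l ≠ i → l ≠ j → ∀ k, A l k = (1 : Matrix (Fin n) (Fin n) L.D) l k)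
    (hii : A i i ∈ L.Ppow 1) (hjj : A j j ∈ L.Ppow 1)
    (haij : A i j ∉ L.Ppow (m i j + 1)) (haji : A j i ∉ L.Ppow (m j i + 1))
    (B C : Matrix (Fin n) (Fin n) L.D) (hB : L.InT m B) (hC : L.InT m C) (hA : A = B * C) :
    L.IsUT m B ∨ L.IsUT m C := by
  classical
  obtain ⟨U, hU, hBU⟩ := exists_reduce h0 htri B C hB hC (Finset.univ.filter fun l => l ≠ i ∧ l ≠ j)
    (by
      intro l hl k
      rw [Finset.mem_filter] at hl
      rw [← hA]
      exact hrow l hl.2.1 hl.2.2 k)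
  obtain ⟨V, hV, hUV, hVU⟩ := hU.exists_inv
  set X := B * U with hX
  set Y := V * C with hY
  have hXY : X * Y = A := by
    rw [hA, hX, hY, mul_assoc, ← mul_assoc U, hUV, one_mul]
  have hXT : L.InT m X := hB.mul htri hU.inT
  have hYT : L.InT m Y := hV.inT.mul htri hC
  have hXrow : ∀ l, l ≠ i → l ≠ j → ∀ k, X l k = (1 : Matrix (Fin n) (Fin n) L.D) l k := by
    intro l h1 h2 k
    exact hBU l (by simp [h1, h2]) k
  have hYrow : ∀ l, l ≠ i → l ≠ j → ∀ k, Y l k = (1 : Matrix (Fin n) (Fin n) L.D) l k := by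
    intro l h1 h2 k
    rw [← hrow l h1 h2 k, ← hXY, Matrix.mul_apply, Finset.sum_eq_single l]
    · rw [hXrow l h1 h2, Matrix.one_apply_eq, one_mul]
    · intro b _ hb
      rw [hXrow l h1 h2, Matrix.one_apply_ne (Ne.symm hb), zero_mul]
    · intro h; exact absurd (Finset.mem_univ _) h
  have hprod : ∀ a b, (b = i ∨ b = j) → A a b = X a i * Y i b + X a j * Y j b := by
    intro a b hb
    rw [← hXY, Matrix.mul_apply, ← Finset.sum_subset (Finset.subset_univ {i, j}),
      Finset.sum_pair hij]
    intro k _ hk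
    simp only [Finset.mem_insert, Finset.mem_singleton, not_or] at hk
    rw [hYrow k hk.1 hk.2, Matrix.one_apply_ne, mul_zero]
    rcases hb with rfl | rfl
    · exact hk.1
    · exact hk.2
  have fin : L.IsUT m X ∨ L.IsUT m Y := by
    have e1 := hprod i i (Or.inl rfl)
    have e2 := hprod i j (Or.inr rfl)
    have e3 := hprod j i (Or.inl rfl)
    have e4 := hprod j j (Or.inr rfl)
    by_cases hXi : X i i ∈ L.Ppow 1
    · right
      have hYj : Y j j ∉ L.Ppow 1 := by
        intro h
        apply haij
        rw [e2]
        refine L.Ppow_add_mem ?_ (L.Ppow_mul_mem (hXT i j) h)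
        rw [add_comm (m i j)]
        exact L.Ppow_mul_mem hXi (hYT i j)
      have hXj : X j j ∈ L.Ppow 1 := by
        by_contra h
        apply mul_not_mem h hYj
        have h1 : X j i * Y i j ∈ L.Ppow 1 :=
          L.Ppow_mono (by omega) (L.Ppow_mul_mem (hXT j i) (hYT i j))
        have := L.Ppow_sub_mem hjj h1
        rwa [e4, add_sub_cancel_left] at this
      have hYi : Y i i ∉ L.Ppow 1 := by
        intro h
        apply haji
        rw [e3]
        refine L.Ppow_add_mem (L.Ppow_mul_mem (hXT j i) h) ?_
        rw [add_comm (m j i)]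
        exact L.Ppow_mul_mem hXj (hYT j i)
      exact isUT_of_two h0 htri i j hij hm Y hYT hYrow hYi hYj
    · left
      have hYi : Y i i ∈ L.Ppow 1 := by
        by_contra h
        apply mul_not_mem hXi h
        have h1 : X i j * Y j i ∈ L.Ppow 1 :=
          L.Ppow_mono (by omega) (L.Ppow_mul_mem (hXT i j) (hYT j i))
        have := L.Ppow_sub_mem hii h1
        rwa [e1, add_sub_cancel_right] at this
      have hXj : X j j ∉ L.Ppow 1 := by
        intro h
        apply haji
        rw [e3]
        refine L.Ppow_add_mem (L.Ppow_mul_mem (hXT j i) hYi) ?_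
        rw [add_comm (m j i)]
        exact L.Ppow_mul_mem h (hYT j i)
      exact isUT_of_two h0 htri i j hij hm X hXT hXrow hXi hXj
  rcases fin with h | h
  · left
    have : B = X * V := by rw [hX, mul_assoc, hUV, mul_one]
    rw [this]; exact h.mul htri hV
  · right
    have : C = U * Y := by rw [hY, ← mul_assoc, hUV, one_mul]
    rw [this]; exact hU.mul htri h

end LocalCSA
end Paper

namespace Paper
namespace LocalCSA
variable {L : LocalCSA} {n : ℕ} {m : Fin n → Fin n → ℤ}

lemma isUnit_matDot_iff (h0 : ∀ i, m i i = 0) (htri : ∀ i j k, m i k ≤ m i j + m j k)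
    (a : ↥(L.matDot (L.stdOrder m id h0 htri))) : IsUnit a ↔ L.IsUT m a.1 := by
  constructor
  · rintro ⟨u, rfl⟩
    exact ⟨(u⁻¹).val.1, u.val.2.1, (u⁻¹).val.2.1, congrArg Subtype.val u.mul_inv,
      congrArg Subtype.val u.inv_mul⟩
  · rintro ⟨B, h1, h2, h3, h4⟩
    have hn : L.nrd B ≠ 0 := (L.nrd_unit B).2 ⟨⟨B, a.1, h4, h3⟩, rfl⟩
    exact ⟨⟨a, ⟨B, h2, hn⟩, Subtype.ext h3, Subtype.ext h4⟩, rfl⟩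

/-- A two-by-two block in rows and columns `i, j`, extended by the identity. -/
def blk (i j : Fin n) (p q r s : L.D) : Matrix (Fin n) (Fin n) L.D := fun a b =>
  if a = i then (if b = i then p else if b = j then q else 0)
  else if a = j then (if b = i then r else if b = j then s else 0)
  else (1 : Matrix (Fin n) (Fin n) L.D) a b

lemma blk_ii (i j : Fin n) (p q r s : L.D) : blk i j p q r s i i = p := by simp [blk]

lemma blk_ij {i j : Fin n} (hij : i ≠ j) (p q r s : L.D) : blk i j p q r s i j = q := by
  simp [blk, hij.symm]

lemma blk_ji {i j : Fin n} (hij : i ≠ j) (p q r s : L.D) : blk i j p q r s j i = r := by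
  simp [blk, hij.symm]

lemma blk_jj {i j : Fin n} (hij : i ≠ j) (p q r s : L.D) : blk i j p q r s j j = s := by
  simp [blk, hij.symm]

lemma blk_row {i j : Fin n} (p q r s : L.D) (l : Fin n) (h1 : l ≠ i) (h2 : l ≠ j) (k : Fin n) :
    blk i j p q r s l k = (1 : Matrix (Fin n) (Fin n) L.D) l k := by
  simp [blk, h1, h2]

lemma blk_mul_row_i {i j : Fin n} (hij : i ≠ j) (p q r s : L.D) (X : Matrix (Fin n) (Fin n) L.D)
    (b : Fin n) : (blk i j p q r s * X) i b = p * X i b + q * X j b := by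
  rw [Matrix.mul_apply, ← Finset.sum_subset (Finset.subset_univ {i, j}), Finset.sum_pair hij,
    blk_ii, blk_ij hij]
  intro k _ hk
  simp only [Finset.mem_insert, Finset.mem_singleton, not_or] at hk
  simp [blk, hk.1, hk.2]

lemma blk_mul_row_j {i j : Fin n} (hij : i ≠ j) (p q r s : L.D) (X : Matrix (Fin n) (Fin n) L.D)
    (b : Fin n) : (blk i j p q r s * X) j b = r * X i b + s * X j b := by
  rw [Matrix.mul_apply, ← Finset.sum_subset (Finset.subset_univ {i, j}), Finset.sum_pair hij,
    blk_ji hij, blk_jj hij]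
  intro k _ hk
  simp only [Finset.mem_insert, Finset.mem_singleton, not_or] at hk
  simp [blk, hk.1, hk.2]

lemma blk_mul_row {i j : Fin n} (p q r s : L.D) (X : Matrix (Fin n) (Fin n) L.D)
    (l : Fin n) (h1 : l ≠ i) (h2 : l ≠ j) (b : Fin n) : (blk i j p q r s * X) l b = X l b := by
  rw [Matrix.mul_apply, Finset.sum_eq_single l]
  · rw [blk_row _ _ _ _ l h1 h2, Matrix.one_apply_eq, one_mul]
  · intro k _ hk
    rw [blk_row _ _ _ _ l h1 h2, Matrix.one_apply_ne (Ne.symm hk), zero_mul]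
  · intro h; exact absurd (Finset.mem_univ _) h

lemma blk_mul {i j : Fin n} (hij : i ≠ j) (p q r s p' q' r' s' : L.D) :
    blk i j p q r s * blk i j p' q' r' s' =
      blk i j (p * p' + q * r') (p * q' + q * s') (r * p' + s * r') (r * q' + s * s') := by
  ext a b
  by_cases ha : a = i
  · subst ha
    rw [blk_mul_row_i hij]
    by_cases hb : b = a
    · subst hb; rw [blk_ii, blk_ii, blk_ji hij]
    · by_cases hb' : b = j
      · subst hb'; rw [blk_ij hij, blk_ij hij, blk_jj hij]
      · simp [blk, hb, hb', hij.symm]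
  · by_cases ha' : a = j
    · subst ha'
      rw [blk_mul_row_j hij]
      by_cases hb : b = i
      · subst hb; rw [blk_ii, blk_ji hij, blk_ji hij]
      · by_cases hb' : b = a
        · subst hb'; rw [blk_ij hij, blk_jj hij, blk_jj hij]
        · simp [blk, hb, hb', hij.symm]
    · rw [blk_mul_row _ _ _ _ _ a ha ha', blk_row _ _ _ _ a ha ha', blk_row _ _ _ _ a ha ha']

lemma blk_one {i j : Fin n} (hij : i ≠ j) :
    blk i j 1 0 0 1 = (1 : Matrix (Fin n) (Fin n) L.D) := by
  ext a b
  by_cases ha : a = i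
  · subst ha
    by_cases hb : b = a
    · subst hb; simp [blk]
    · simp [blk, hb, Matrix.one_apply_ne (Ne.symm hb)]
  · by_cases ha' : a = j
    · subst ha'
      by_cases hb : b = a
      · subst hb; simp [blk, hij.symm]
      · simp [blk, hb, hij.symm, Matrix.one_apply_ne (Ne.symm hb)]
    · rw [blk_row _ _ _ _ a ha ha']

lemma blk_pow {i j : Fin n} (hij : i ≠ j) (x : L.D) (N : ℕ) :
    (blk i j x 0 0 x : Matrix (Fin n) (Fin n) L.D) ^ N = blk i j (x ^ N) 0 0 (x ^ N) := by
  induction N with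
  | zero => simp [blk_one hij]
  | succ N ih => rw [pow_succ, ih, blk_mul hij]; simp [pow_succ]

lemma inT_blk (h0 : ∀ i, m i i = 0) {i j : Fin n} (hij : i ≠ j) {p q r s : L.D}
    (hp : p ∈ L.Ppow 0) (hq : q ∈ L.Ppow (m i j)) (hr : r ∈ L.Ppow (m j i)) (hs : s ∈ L.Ppow 0) :
    L.InT m (blk i j p q r s) := by
  intro a b
  by_cases ha : a = i
  · subst ha
    by_cases hb : b = a
    · subst hb; rw [blk_ii, h0]; exact hp
    · by_cases hb' : b = j
      · subst hb'; rw [blk_ij hij]; exact hq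
      · simp only [blk, if_true, if_neg hb, if_neg hb']; exact Or.inl rfl
  · by_cases ha' : a = j
    · subst ha'
      by_cases hb : b = i
      · subst hb; rw [blk_ji hij]; exact hr
      · by_cases hb' : b = a
        · subst hb'; rw [blk_jj hij, h0]; exact hs
        · simp only [blk, if_true, if_neg ha, if_neg hb, if_neg hb']; exact Or.inl rfl
    · rw [blk_row _ _ _ _ a ha ha']; exact InT.one h0 a b

lemma not_isUT_blk (h0 : ∀ i, m i i = 0) {i j : Fin n} (hij : i ≠ j) (hm : 1 ≤ m i j + m j i)
    {p q r s : L.D} (hp : p ∈ L.Ppow 1) (hq : q ∈ L.Ppow (m i j)) :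
    ¬ L.IsUT m (blk i j p q r s) := by
  rintro ⟨B, _, hB, h1, _⟩
  have h2 := congrFun (congrFun h1 i) i
  rw [blk_mul_row_i hij, Matrix.one_apply_eq] at h2
  have h3 : (1 : L.D) ∈ L.Ppow 1 := by
    rw [← h2]
    refine L.Ppow_add_mem ?_ (L.Ppow_mono hm (L.Ppow_mul_mem hq (hB j i)))
    have := L.Ppow_mul_mem hp (hB i i)
    rwa [h0, add_zero] at this
  rw [L.mem_Ppow_of_ne one_ne_zero, L.w_one] at h3
  omega

lemma zpow_not_mem (k : ℤ) : L.ϖ ^ k ∉ L.Ppow (k + 1) := by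
  rw [L.mem_Ppow_of_ne (zpow_ne_zero _ L.ϖ_ne), L.w_zpow]; omega

lemma elasticity_std_eq_top (h0 : ∀ i, m i i = 0) (htri : ∀ i j k, m i k ≤ m i j + m j k)
    (len : ↥(L.matDot (L.stdOrder m id h0 htri)) → ℕ)
    (hmul : ∀ a b, len (a * b) = len a + len b) (hunit : ∀ a, len a = 0 ↔ IsUnit a)
    (i j : Fin n) (hm : 2 ≤ m i j + m j i) :
    elasticity ↥(L.matDot (L.stdOrder m id h0 htri)) = ⊤ := by
  have hij : i ≠ j := by
    rintro rfl
    rw [h0] at hm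
    omega
  refine elasticity_eq_top_of len hmul hunit fun N => ?_
  have hϖ := L.ϖ_ne
  set s := m i j + m j i with hs
  set x : L.D := L.ϖ ^ (m i j) with hx
  set y : L.D := L.ϖ ^ (m j i) + L.ϖ ^ (m j i + ((N : ℤ) + 1)) with hy
  set t : L.D := L.ϖ ^ (s - 1) with ht
  have hxm : x ∈ L.Ppow (m i j) := L.zpow_mem _
  have hxn : x ∉ L.Ppow (m i j + 1) := zpow_not_mem _
  have hy2 : L.ϖ ^ (m j i + ((N : ℤ) + 1)) ∈ L.Ppow (m j i + 1) :=
    L.Ppow_mono (by omega) (L.zpow_mem _)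
  have hym : y ∈ L.Ppow (m j i) :=
    L.Ppow_add_mem (L.zpow_mem _) (L.Ppow_mono (by omega) hy2)
  have hyn : y ∉ L.Ppow (m j i + 1) := by
    intro h
    apply zpow_not_mem (L := L) (m j i)
    have := L.Ppow_sub_mem h hy2
    rwa [hy, add_sub_cancel_right] at this
  have ht1 : t ∈ L.Ppow 1 := L.Ppow_mono (by omega) (L.zpow_mem _)
  have hϖ1 : L.ϖ ∈ L.Ppow 1 := Or.inr L.w_ϖ.ge
  have h10 : ∀ z, z ∈ L.Ppow 1 → z ∈ L.Ppow 0 := fun z hz => L.Ppow_mono (by omega) hz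
  set A : Matrix (Fin n) (Fin n) L.D := blk i j L.ϖ x y t with hA
  set A' : Matrix (Fin n) (Fin n) L.D := blk i j t (-x) (-y) L.ϖ with hA'
  set D : Matrix (Fin n) (Fin n) L.D := blk i j L.ϖ 0 0 L.ϖ with hD
  set e : L.D := -L.ϖ ^ (s + 1) with he
  set E : Matrix (Fin n) (Fin n) L.D := blk i j e 0 0 e with hE
  have he0 : e ≠ 0 := neg_ne_zero.2 (zpow_ne_zero _ hϖ)
  have he1 : e ∈ L.Ppow 1 := L.Ppow_neg_mem (L.Ppow_mono (by omega) (L.zpow_mem _))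
  have hprod : A * A' = D ^ N * E := by
    rw [hA, hA', hD, hE, blk_pow hij, blk_mul hij, blk_mul hij]
    have c1 : L.ϖ * t = L.ϖ ^ s := by
      rw [ht, ← zpow_one_add₀ hϖ]; congr 1; omega
    have c1' : t * L.ϖ = L.ϖ ^ s := by
      rw [ht, ← zpow_add_one₀ hϖ]; congr 1; omega
    have c2 : x * y = L.ϖ ^ s + L.ϖ ^ (s + ((N : ℤ) + 1)) := by
      rw [hx, hy, mul_add, ← zpow_add₀ hϖ, ← zpow_add₀ hϖ, hs, add_assoc]
    have c3 : y * x = L.ϖ ^ s + L.ϖ ^ (s + ((N : ℤ) + 1)) := by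
      rw [hx, hy, add_mul, ← zpow_add₀ hϖ, ← zpow_add₀ hϖ, hs]
      congr 2 <;> ring
    have c4 : L.ϖ ^ N * e = -L.ϖ ^ (s + ((N : ℤ) + 1)) := by
      rw [he, mul_neg, ← zpow_natCast, ← zpow_add₀ hϖ]
      congr 2; ring
    have cx : L.ϖ * x = x * L.ϖ := by
      rw [hx, ← zpow_one_add₀ hϖ, ← zpow_add_one₀ hϖ, add_comm]
    have cy : y * t = t * y := by
      rw [hy, ht, add_mul, mul_add]
      simp only [← zpow_add₀ hϖ]
      congr 2 <;> ring
    congr 1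
    · rw [c1, mul_neg, c2, c4]; simp
    · rw [mul_neg, cx]; simp
    · rw [mul_neg, cy]; simp
    · rw [mul_neg, c3, c1', c4]; simp
  have hDu : IsUnit D := by
    refine ⟨⟨D, blk i j L.ϖ⁻¹ 0 0 L.ϖ⁻¹, ?_, ?_⟩, rfl⟩
    · rw [hD, blk_mul hij]; simp [hϖ, blk_one hij]
    · rw [hD, blk_mul hij]; simp [hϖ, blk_one hij]
  have hEu : IsUnit E := by
    refine ⟨⟨E, blk i j e⁻¹ 0 0 e⁻¹, ?_, ?_⟩, rfl⟩
    · rw [hE, blk_mul hij]; simp [he0, blk_one hij]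
    · rw [hE, blk_mul hij]; simp [he0, blk_one hij]
  have hDn := (L.nrd_unit D).2 hDu
  have hEn := (L.nrd_unit E).2 hEu
  have hAA : L.nrd A * L.nrd A' ≠ 0 := by
    rw [← L.nrd_mul, hprod]
    exact (L.nrd_unit _).2 ((hDu.pow N).mul hEu)
  have hAT : L.InT m A := inT_blk h0 hij (h10 _ hϖ1) hxm hym (h10 _ ht1)
  have hAT' : L.InT m A' :=
    inT_blk h0 hij (h10 _ ht1) (L.Ppow_neg_mem hxm) (L.Ppow_neg_mem hym) (h10 _ hϖ1)
  have hDT : L.InT m D := inT_blk h0 hij (h10 _ hϖ1) (Or.inl rfl) (Or.inl rfl) (h10 _ hϖ1)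
  have hET : L.InT m E := inT_blk h0 hij (h10 _ he1) (Or.inl rfl) (Or.inl rfl) (h10 _ he1)
  have hneg : ∀ (z : L.D) (k : ℤ), z ∉ L.Ppow k → -z ∉ L.Ppow k := by
    intro z k hz h
    apply hz
    have := L.Ppow_neg_mem h
    rwa [neg_neg] at this
  refine ⟨⟨A, hAT, left_ne_zero_of_mul hAA⟩, ⟨A', hAT', right_ne_zero_of_mul hAA⟩,
    ⟨D, hDT, hDn⟩, ⟨E, hET, hEn⟩, ⟨?_, ?_⟩, ⟨?_, ?_⟩, ?_, ?_, Subtype.ext hprod⟩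
  · rw [isUnit_matDot_iff]
    exact not_isUT_blk h0 hij (by omega) hϖ1 hxm
  · intro b c hbc
    rw [isUnit_matDot_iff, isUnit_matDot_iff]
    refine atom_criterion h0 htri i j hij (by omega) A (blk_row _ _ _ _) ?_ ?_ ?_ ?_ b.1 c.1
      b.2.1 c.2.1 (congrArg Subtype.val hbc)
    · rw [hA, blk_ii]; exact hϖ1
    · rw [hA, blk_jj hij]; exact ht1
    · rw [hA, blk_ij hij]; exact hxn
    · rw [hA, blk_ji hij]; exact hyn
  · rw [isUnit_matDot_iff]
    exact not_isUT_blk h0 hij (by omega) ht1 (L.Ppow_neg_mem hxm)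
  · intro b c hbc
    rw [isUnit_matDot_iff, isUnit_matDot_iff]
    refine atom_criterion h0 htri i j hij (by omega) A' (blk_row _ _ _ _) ?_ ?_ ?_ ?_ b.1 c.1
      b.2.1 c.2.1 (congrArg Subtype.val hbc)
    · rw [hA', blk_ii]; exact ht1
    · rw [hA', blk_jj hij]; exact hϖ1
    · rw [hA', blk_ij hij]; exact hneg _ _ hxn
    · rw [hA', blk_ji hij]; exact hneg _ _ hyn
  · rw [isUnit_matDot_iff]
    exact not_isUT_blk h0 hij (by omega) hϖ1 (Or.inl rfl)
  · rw [isUnit_matDot_iff]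
    exact not_isUT_blk h0 hij (by omega) he1 (Or.inl rfl)

end LocalCSA
end Paper

namespace Paper
namespace LocalCSA

lemma exists_min_rel {α : Type*} (r : α → α → Prop) (hr : ∀ a, r a a)
    (ht : ∀ a b c, r a b → r b c → r a c) (s : Finset α) (hs : s.Nonempty) :
    ∃ p ∈ s, ∀ q ∈ s, r q p → r p q := by
  letI : Preorder α := { le := r, le_refl := hr, le_trans := ht }
  obtain ⟨p, hp⟩ := Finset.exists_minimal hs
  exact ⟨p, hp.1, fun q hq h => hp.2 hq h⟩

variable {L : LocalCSA} {n : ℕ} {m : Fin n → Fin n → ℤ}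

lemma InT.add {B C : Matrix (Fin n) (Fin n) L.D} (hB : L.InT m B) (hC : L.InT m C) :
    L.InT m (B + C) := fun a b => L.Ppow_add_mem (hB a b) (hC a b)

lemma InT.neg {B : Matrix (Fin n) (Fin n) L.D} (hB : L.InT m B) :
    L.InT m (-B) := fun a b => L.Ppow_neg_mem (hB a b)

lemma isUT_one_add (h0 : ∀ i, m i i = 0) (N : Matrix (Fin n) (Fin n) L.D) (hN : L.InT m N)
    (hNN : N * N = 0) : L.IsUT m (1 + N) := by
  refine ⟨1 + -N, (InT.one h0).add hN, (InT.one h0).add hN.neg, ?_, ?_⟩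
  · simp [mul_add, add_mul, hNN]
  · simp [mul_add, add_mul, hNN]

/-- The matrix with column `i` equal to `c` and zero elsewhere. -/
def colM (i : Fin n) (c : Fin n → L.D) : Matrix (Fin n) (Fin n) L.D :=
  fun a b => if b = i then c a else 0

/-- The matrix with row `j` equal to `r` and zero elsewhere. -/
def rowM (j : Fin n) (r : Fin n → L.D) : Matrix (Fin n) (Fin n) L.D :=
  fun a b => if a = j then r b else 0

lemma colM_mul (i : Fin n) (c : Fin n → L.D) (B : Matrix (Fin n) (Fin n) L.D) (a b : Fin n) :
    (colM i c * B) a b = c a * B i b := by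
  simp [Matrix.mul_apply, colM]

lemma mul_rowM (j : Fin n) (r : Fin n → L.D) (B : Matrix (Fin n) (Fin n) L.D) (a b : Fin n) :
    (B * rowM j r) a b = B a j * r b := by
  simp [Matrix.mul_apply, rowM]

lemma isUT_colM (h0 : ∀ i, m i i = 0) (i : Fin n) (c : Fin n → L.D)
    (hc : ∀ a, c a ∈ L.Ppow (m a i)) (hci : c i = 0) : L.IsUT m (1 + colM i c) := by
  refine isUT_one_add h0 _ ?_ ?_
  · intro a b
    unfold colM
    split_ifs with h
    · rw [h]; exact hc a
    · exact Or.inl rfl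
  · ext a b
    rw [colM_mul]
    simp [colM, hci]

lemma isUT_rowM (h0 : ∀ i, m i i = 0) (j : Fin n) (r : Fin n → L.D)
    (hr : ∀ b, r b ∈ L.Ppow (m j b)) (hrj : r j = 0) : L.IsUT m (1 + rowM j r) := by
  refine isUT_one_add h0 _ ?_ ?_
  · intro a b
    unfold rowM
    split_ifs with h
    · rw [h]; exact hr b
    · exact Or.inl rfl
  · ext a b
    rw [mul_rowM]
    simp [rowM, hrj]

/-- Row `i` of `B` has one nonzero entry, alone in its column. -/
def Good (B : Matrix (Fin n) (Fin n) L.D) (i j : Fin n) : Prop :=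
  B i j ≠ 0 ∧ (∀ k, k ≠ j → B i k = 0) ∧ (∀ k, k ≠ i → B k j = 0)

lemma exists_pivot (h0 : ∀ i, m i i = 0) (htri : ∀ i j k, m i k ≤ m i j + m j k)
    (hH : ∀ i j, m i j + m j i ≤ 1) (B : Matrix (Fin n) (Fin n) L.D) (hB : IsUnit B)
    (S : Finset (Fin n)) (hS : ∀ i ∈ S, ∃ j, Good B i j) (i0 : Fin n) (hi0 : i0 ∉ S) :
    ∃ i j, i ∉ S ∧ B i j ≠ 0 ∧ (∀ k, B k j ≠ 0 → L.w (B i j) + m k i ≤ L.w (B k j)) ∧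
      (∀ l, B i l ≠ 0 → L.w (B i j) + m j l ≤ L.w (B i l)) := by
  classical
  have hrow : ∃ j, B i0 j ≠ 0 := by
    by_contra hcon
    push Not at hcon
    obtain ⟨B', hBB', -⟩ := isUnit_iff_exists.1 hB
    have : (B * B') i0 i0 = 0 := by
      rw [Matrix.mul_apply]
      exact Finset.sum_eq_zero fun k _ => by rw [hcon k, zero_mul]
    rw [hBB', Matrix.one_apply_eq] at this
    exact one_ne_zero this
  obtain ⟨j0, hj0⟩ := hrow
  obtain ⟨⟨i, j⟩, hp, hmin⟩ := exists_min_rel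
    (fun p q : Fin n × Fin n => L.w (B p.1 p.2) + m q.1 p.1 + m p.2 q.2 ≤ L.w (B q.1 q.2))
    (fun p => by simp [h0])
    (fun p q s h1 h2 => by
      have := htri s.1 q.1 p.1
      have := htri p.2 q.2 s.2
      omega)
    (Finset.univ.filter fun p : Fin n × Fin n => p.1 ∉ S ∧ B p.1 p.2 ≠ 0)
    ⟨(i0, j0), by simp [hi0, hj0]⟩
  simp only [Finset.mem_filter, Finset.mem_univ, true_and, Prod.forall] at hp hmin
  have hSj : ∀ k, B k j ≠ 0 → k ∉ S := by
    intro k hk hkS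
    obtain ⟨jk, g1, g2, g3⟩ := hS k hkS
    by_cases h : j = jk
    · subst h
      exact hp.2 (g3 i (by rintro rfl; exact hp.1 hkS))
    · exact hk (g2 j h)
  refine ⟨i, j, hp.1, hp.2, ?_, ?_⟩
  · intro k hk
    by_contra hcon
    have h1 := hH k i
    have := hmin k j ⟨hSj k hk, hk⟩ (by have := h0 j; omega)
    have := h0 j
    omega
  · intro l hl
    by_contra hcon
    have h1 := hH j l
    have := hmin i l ⟨hp.1, hl⟩ (by have := h0 i; omega)
    have := h0 i
    omega

lemma bruhat_step (h0 : ∀ i, m i i = 0) (htri : ∀ i j k, m i k ≤ m i j + m j k)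
    (hH : ∀ i j, m i j + m j i ≤ 1) (B : Matrix (Fin n) (Fin n) L.D) (hB : IsUnit B)
    (S : Finset (Fin n)) (hS : ∀ i ∈ S, ∃ j, Good B i j) (i0 : Fin n) (hi0 : i0 ∉ S) :
    ∃ i, i ∉ S ∧ ∃ U V, L.IsUT m U ∧ L.IsUT m V ∧
      ∀ k ∈ insert i S, ∃ j, Good (U * B * V) k j := by
  classical
  obtain ⟨i, j, hiS, hij, hcol, hrow⟩ := exists_pivot h0 htri hH B hB S hS i0 hi0
  set c : Fin n → L.D := fun a => if a = i then 0 else -(B a j * (B i j)⁻¹) with hc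
  set r : Fin n → L.D := fun b => if b = j then 0 else -((B i j)⁻¹ * B i b) with hr
  have hci : c i = 0 := by simp [hc]
  have hrj : r j = 0 := by simp [hr]
  have hcT : ∀ a, c a ∈ L.Ppow (m a i) := by
    intro a
    by_cases ha : a = i
    · rw [ha, hci]; exact Or.inl rfl
    · simp only [hc, if_neg ha]
      apply L.Ppow_neg_mem
      by_cases h : B a j = 0
      · rw [h, zero_mul]; exact Or.inl rfl
      · right
        rw [L.w_mul _ _ h (inv_ne_zero hij), L.w_inv _ hij]
        have := hcol a h
        omega
  have hrT : ∀ b, r b ∈ L.Ppow (m j b) := by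
    intro b
    by_cases hb : b = j
    · rw [hb, hrj]; exact Or.inl rfl
    · simp only [hr, if_neg hb]
      apply L.Ppow_neg_mem
      by_cases h : B i b = 0
      · rw [h, mul_zero]; exact Or.inl rfl
      · right
        rw [L.w_mul _ _ (inv_ne_zero hij) h, L.w_inv _ hij]
        have := hrow b h
        omega
  refine ⟨i, hiS, 1 + colM i c, 1 + rowM j r, isUT_colM h0 i c hcT hci, isUT_rowM h0 j r hrT hrj, ?_⟩
  have e1 : ∀ a b, ((1 + colM i c) * B) a b = B a b + c a * B i b := by
    intro a b
    rw [add_mul, one_mul, Matrix.add_apply, colM_mul]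
  have e2 : ∀ a b, ((1 + colM i c) * B * (1 + rowM j r)) a b =
      (B a b + c a * B i b) + (B a j + c a * B i j) * r b := by
    intro a b
    rw [mul_add, mul_one, Matrix.add_apply, mul_rowM, e1, e1]
  have hz : ∀ a, a ≠ i → B a j + c a * B i j = 0 := by
    intro a ha
    simp [hc, ha, hij]
  intro k hk
  rcases Finset.mem_insert.1 hk with rfl | hkS
  · refine ⟨j, ?_, ?_, ?_⟩
    · rw [e2, hci, hrj]; simpa using hij
    · intro b hb
      rw [e2, hci]
      simp [hr, hb, hij]
    · intro a ha
      rw [e2, hz a ha, hrj]; simp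
  · have hki : k ≠ i := by rintro rfl; exact hiS hkS
    obtain ⟨l, g1, g2, g3⟩ := hS k hkS
    have hil : B i l = 0 := g3 i (Ne.symm hki)
    have hlj : l ≠ j := by rintro rfl; exact hij hil
    have hck : c k = 0 := by simp [hc, g2 j (Ne.symm hlj)]
    have hrl : r l = 0 := by simp [hr, hil]
    refine ⟨l, ?_, ?_, ?_⟩
    · rw [e2, hrl, hil]; simpa using g1
    · intro b hb
      rw [e2, hz k hki, hck, g2 b hb]; simp
    · intro a ha
      rw [e2, hil, hrl, g3 a ha]; simp

lemma bruhat_aux (h0 : ∀ i, m i i = 0) (htri : ∀ i j k, m i k ≤ m i j + m j k)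
    (hH : ∀ i j, m i j + m j i ≤ 1) (A : Matrix (Fin n) (Fin n) L.D) (hA : IsUnit A) (c : ℕ)
    (hc : c ≤ n) : ∃ S : Finset (Fin n), S.card = c ∧ ∃ U V, L.IsUT m U ∧ L.IsUT m V ∧
      ∀ k ∈ S, ∃ j, Good (U * A * V) k j := by
  classical
  induction c with
  | zero => exact ⟨∅, rfl, 1, 1, IsUT.one h0, IsUT.one h0, by simp⟩
  | succ c ih =>
    obtain ⟨S, hSc, U, V, hU, hV, hS⟩ := ih (by omega)
    have : ∃ i0, i0 ∉ S := by
      by_contra hcon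
      push Not at hcon
      have : S = Finset.univ := Finset.eq_univ_iff_forall.2 hcon
      rw [this, Finset.card_univ, Fintype.card_fin] at hSc
      omega
    obtain ⟨i0, hi0⟩ := this
    obtain ⟨i, hi, U', V', hU', hV', hg⟩ := bruhat_step h0 htri hH (U * A * V)
      ((hU.isUnit.mul hA).mul hV.isUnit) S hS i0 hi0
    refine ⟨insert i S, by rw [Finset.card_insert_of_notMem hi, hSc], U' * U, V * V',
      hU'.mul htri hU, hV.mul htri hV', ?_⟩
    have : U' * U * A * (V * V') = U' * (U * A * V) * V' := by simp only [mul_assoc]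
    rw [this]
    exact hg

lemma bruhat (h0 : ∀ i, m i i = 0) (htri : ∀ i j k, m i k ≤ m i j + m j k)
    (hH : ∀ i j, m i j + m j i ≤ 1) (A : Matrix (Fin n) (Fin n) L.D) (hA : IsUnit A) :
    ∃ U V, L.IsUT m U ∧ L.IsUT m V ∧ ∃ σ : Fin n → Fin n, ∀ k, Good (U * A * V) k (σ k) := by
  obtain ⟨S, hSc, U, V, hU, hV, hS⟩ := bruhat_aux h0 htri hH A hA n le_rfl
  have : S = Finset.univ := by
    rw [← Finset.card_eq_iff_eq_univ, hSc, Fintype.card_fin]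
  choose σ hσ using fun k => hS k (by rw [this]; exact Finset.mem_univ k)
  exact ⟨U, V, hU, hV, σ, hσ⟩

end LocalCSA
end Paper

namespace Paper
namespace LocalCSA
variable {L : LocalCSA} {n : ℕ} {m : Fin n → Fin n → ℤ}

lemma inT_diagonal (h0 : ∀ i, m i i = 0) (d : Fin n → L.D) (hd : ∀ i, d i ∈ L.Ppow 0) :
    L.InT m (Matrix.diagonal d) := by
  intro a b
  by_cases h : a = b
  · subst h
    rw [Matrix.diagonal_apply_eq, h0]; exact hd a
  · rw [Matrix.diagonal_apply_ne _ h]; exact Or.inl rfl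

theorem elasticity_std_lt_top (h0 : ∀ i, m i i = 0) (htri : ∀ i j k, m i k ≤ m i j + m j k)
    (hH : ∀ i j, m i j + m j i ≤ 1)
    (len : ↥(L.matDot (L.stdOrder m id h0 htri)) → ℕ)
    (hmul : ∀ a b, len (a * b) = len a + len b) (hunit : ∀ a, len a = 0 ↔ IsUnit a) :
    elasticity ↥(L.matDot (L.stdOrder m id h0 htri)) < ⊤ := by
  classical
  -- elements of the monoid
  let mk : ∀ B : Matrix (Fin n) (Fin n) L.D, L.InT m B → IsUnit B →
      ↥(L.matDot (L.stdOrder m id h0 htri)) := fun B h1 h2 => ⟨B, h1, (L.nrd_unit B).2 h2⟩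
  let b : Matrix (Fin n) (Fin n) L.D → ℕ := fun X =>
    if h : L.InT m X ∧ IsUnit X then len (mk X h.1 h.2) else 0
  have hb : ∀ X h1 h2, b X = len (mk X h1 h2) := fun X h1 h2 => dif_pos ⟨h1, h2⟩
  have hUT0 : ∀ X (h : L.IsUT m X), len (mk X h.inT h.isUnit) = 0 := by
    intro X h
    rw [hunit, isUnit_matDot_iff h0 htri]
    exact h
  let D : Fin n → Matrix (Fin n) (Fin n) L.D := fun i => Matrix.diagonal (Function.update 1 i L.ϖ)
  let D' : Fin n → Matrix (Fin n) (Fin n) L.D :=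
    fun i => Matrix.diagonal (Function.update 1 i L.ϖ⁻¹)
  have hDD' : ∀ i, D i * D' i = 1 := by
    intro i
    simp only [D, D', Matrix.diagonal_mul_diagonal]
    rw [← Matrix.diagonal_one]
    congr 1
    funext a
    by_cases h : a = i
    · subst h; simp [L.ϖ_ne]
    · simp [h]
  have hD'D : ∀ i, D' i * D i = 1 := by
    intro i
    simp only [D, D', Matrix.diagonal_mul_diagonal]
    rw [← Matrix.diagonal_one]
    congr 1
    funext a
    by_cases h : a = i
    · subst h; simp [L.ϖ_ne]
    · simp [h]
  have hDu : ∀ i, IsUnit (D i) := fun i => ⟨⟨D i, D' i, hDD' i, hD'D i⟩, rfl⟩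
  have hD'u : ∀ i, IsUnit (D' i) := fun i => ⟨⟨D' i, D i, hD'D i, hDD' i⟩, rfl⟩
  have hDT : ∀ i, L.InT m (D i) := by
    intro i
    apply inT_diagonal h0
    intro a
    by_cases h : a = i
    · subst h
      right; simp [L.w_ϖ]
    · simpa [h] using L.Ppow_one_mem le_rfl
  have hDn : ∀ i, ¬ L.IsUT m (D i) := by
    rintro i ⟨X, -, hX, hDX, -⟩
    have h1 : (D i * X) i i = 1 := by rw [hDX, Matrix.one_apply_eq]
    simp only [D, Matrix.diagonal_mul, Function.update_self] at h1
    have h2 : L.ϖ * X i i ∈ L.Ppow (1 + m i i) :=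
      L.Ppow_mul_mem (Or.inr L.w_ϖ.ge) (hX i i)
    rw [h1, h0, L.mem_Ppow_of_ne one_ne_zero, L.w_one] at h2
    omega
  let Mσ : (Fin n → Fin n) → Matrix (Fin n) (Fin n) L.D :=
    fun σ x y => if y = σ x then L.ϖ ^ (m x y) else 0
  refine elasticity_lt_top_of_len len hmul hunit (∑ i, b (D i) + ∑ σ, b (Mσ σ)) ?_
  intro a ha
  have haT : L.InT m a.1 := a.2.1
  have haU : IsUnit a.1 := (L.nrd_unit _).1 a.2.2
  obtain ⟨U, V, hU, hV, σ, hσ⟩ := bruhat h0 htri hH a.1 haU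
  obtain ⟨U', hU', hUU', hU'U⟩ := hU.exists_inv
  obtain ⟨V', hV', hVV', hV'V⟩ := hV.exists_inv
  set M := U * a.1 * V with hM
  have hMT : L.InT m M := (hU.inT.mul htri haT).mul htri hV.inT
  have hMu : IsUnit M := (hU.isUnit.mul haU).mul hV.isUnit
  have haM : a.1 = U' * M * V' := by
    rw [hM]
    calc a.1 = (U' * U) * a.1 * (V * V') := by rw [hU'U, hVV', one_mul, mul_one]
      _ = _ := by simp only [mul_assoc]
  by_cases hex : ∃ i, M i (σ i) ∈ L.Ppow (m i (σ i) + 1)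
  · obtain ⟨i, hi⟩ := hex
    have hN : L.InT m (D' i * M) := by
      intro x y
      simp only [D', Matrix.diagonal_mul]
      by_cases hx : x = i
      · subst hx
        rw [Function.update_self]
        by_cases hy : y = σ x
        · rw [hy]
          have : L.ϖ⁻¹ ∈ L.Ppow (-1) := Or.inr (by rw [L.w_inv _ L.ϖ_ne, L.w_ϖ])
          have := L.Ppow_mul_mem this hi
          exact L.Ppow_mono (by omega) this
        · rw [(hσ x).2.1 y hy, mul_zero]; exact Or.inl rfl
      · simpa [hx] using hMT x y
    have hNu : IsUnit (D' i * M) := (hD'u i).mul hMu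
    have hfac : a = mk (U' * D i) (hU'.inT.mul htri (hDT i)) (hU'.isUnit.mul (hDu i)) *
        mk (D' i * M * V') (hN.mul htri hV'.inT) (hNu.mul hV'.isUnit) := by
      apply Subtype.ext
      change a.1 = (U' * D i) * (D' i * M * V')
      rw [haM]
      calc U' * M * V' = U' * (D i * D' i) * M * V' := by rw [hDD', mul_one]
        _ = _ := by simp only [mul_assoc]
    have hfac2 : mk (U' * D i) (hU'.inT.mul htri (hDT i)) (hU'.isUnit.mul (hDu i)) =
        mk U' hU'.inT hU'.isUnit * mk (D i) (hDT i) (hDu i) := rfl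
    have hle : len a ≤ b (D i) := by
      rcases ha.2 _ _ hfac with h | h
      · exfalso
        rw [isUnit_matDot_iff h0 htri] at h
        apply hDn i
        have : D i = U * (U' * D i) := by rw [← mul_assoc, hUU', one_mul]
        rw [this]
        exact hU.mul htri h
      · rw [hfac, hmul, (hunit _).2 h, hfac2, hmul, hUT0 U' hU', hb (D i) (hDT i) (hDu i)]
        omega
    refine hle.trans (le_trans ?_ (Nat.le_add_right _ _))
    exact Finset.single_le_sum (f := fun i => b (D i)) (fun _ _ => Nat.zero_le _) (Finset.mem_univ i)
  · push Not at hex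
    have hw : ∀ i, L.w (M i (σ i)) = m i (σ i) := by
      intro i
      have h1 := (L.not_mem_Ppow.1 (hex i)).2
      have h2 := (L.mem_Ppow_of_ne (hσ i).1).1 (hMT i (σ i))
      omega
    have hp : ∀ k : ℤ, L.ϖ ^ k ≠ 0 := fun k => zpow_ne_zero k L.ϖ_ne
    let e : Fin n → L.D := fun i => M i (σ i) * (L.ϖ ^ (m i (σ i)))⁻¹
    have he : ∀ i, e i ≠ 0 := fun i => mul_ne_zero (hσ i).1 (inv_ne_zero (hp _))
    have hwe : ∀ i, L.w (e i) = 0 := by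
      intro i
      simp only [e]
      rw [L.w_mul _ _ (hσ i).1 (inv_ne_zero (hp _)), L.w_inv _ (hp _), L.w_zpow, hw]
      omega
    have hEU : L.IsUT m (Matrix.diagonal e) := by
      refine ⟨Matrix.diagonal fun i => (e i)⁻¹, inT_diagonal h0 _ fun i => Or.inr (hwe i).ge,
        inT_diagonal h0 _ fun i => Or.inr (by rw [L.w_inv _ (he i), hwe]; rfl), ?_, ?_⟩
      · rw [Matrix.diagonal_mul_diagonal, ← Matrix.diagonal_one]
        congr 1; funext i; exact mul_inv_cancel₀ (he i)
      · rw [Matrix.diagonal_mul_diagonal, ← Matrix.diagonal_one]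
        congr 1; funext i; exact inv_mul_cancel₀ (he i)
    have hME : M = Matrix.diagonal e * Mσ σ := by
      ext x y
      rw [Matrix.diagonal_mul]
      simp only [Mσ]
      split_ifs with h
      · rw [h]; simp only [e]; rw [mul_assoc, inv_mul_cancel₀ (hp _), mul_one]
      · rw [(hσ x).2.1 y h, mul_zero]
    have hσT : L.InT m (Mσ σ) := by
      intro x y
      simp only [Mσ]
      split_ifs
      · exact L.zpow_mem _
      · exact Or.inl rfl
    obtain ⟨E', hE', hEE', hE'E⟩ := hEU.exists_inv
    have hσu : IsUnit (Mσ σ) := by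
      have : Mσ σ = E' * M := by rw [hME, ← mul_assoc, hE'E, one_mul]
      rw [this]; exact hE'.isUnit.mul hMu
    have hfac : a = mk U' hU'.inT hU'.isUnit * mk _ hEU.inT hEU.isUnit * mk (Mσ σ) hσT hσu *
        mk V' hV'.inT hV'.isUnit := by
      apply Subtype.ext
      change a.1 = U' * Matrix.diagonal e * Mσ σ * V'
      rw [haM, hME]
      simp only [mul_assoc]
    have hle : len a ≤ b (Mσ σ) := by
      rw [hfac, hmul, hmul, hmul, hUT0 U' hU', hUT0 _ hEU, hUT0 V' hV', hb (Mσ σ) hσT hσu]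
      omega
    refine hle.trans (le_trans ?_ (Nat.le_add_left _ _))
    exact Finset.single_le_sum (f := fun σ => b (Mσ σ)) (fun _ _ => Nat.zero_le _)
      (Finset.mem_univ σ)

end LocalCSA
end Paper

namespace Paper
namespace LocalCSA
variable {L : LocalCSA} {n : ℕ} {m : Fin n → Fin n → ℤ}

open MulOpposite in
theorem not_hereditary_std (h0 : ∀ i, m i i = 0) (htri : ∀ i j k, m i k ≤ m i j + m j k)
    (i j : Fin n) (hm : 2 ≤ m i j + m j i) :
    ¬ IsHereditaryRing ↥(L.stdOrder m (id : Fin n → Fin n) h0 htri) := by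
  classical
  intro hher
  have hsingle : ∀ (a b : Fin n) (x : L.D), x ∈ L.Ppow (m a b) →
      Matrix.single a b x ∈ L.stdOrder m (id : Fin n → Fin n) h0 htri := by
    intro a b x hx c d
    by_cases h : a = c ∧ b = d
    · obtain ⟨rfl, rfl⟩ := h
      rw [Matrix.single_apply_same]; exact hx
    · rw [Matrix.single_apply_of_ne (h := h)]; exact Or.inl rfl
  have hϖ1 : L.ϖ ∈ L.Ppow 1 := Or.inr L.w_ϖ.ge
  have hϖ0 : L.ϖ ∈ L.Ppow 0 := L.Ppow_mono (by omega) hϖ1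
  let R := ↥(L.stdOrder m (id : Fin n → Fin n) h0 htri)
  let g1 : R := ⟨Matrix.single i i L.ϖ, hsingle _ _ _ (by rw [h0]; exact hϖ0)⟩
  let g2 : R := ⟨Matrix.single i j (L.ϖ ^ (m i j)), hsingle _ _ _ (L.zpow_mem _)⟩
  let s1 : R := ⟨Matrix.single i j (L.ϖ ^ (m i j)), hsingle _ _ _ (L.zpow_mem _)⟩
  let s2 : R := ⟨Matrix.single j j L.ϖ, hsingle _ _ _ (by rw [h0]; exact hϖ0)⟩
  let I : Submodule Rᵐᵒᵖ R := Submodule.span Rᵐᵒᵖ {g1, g2}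
  have hproj : Module.Projective Rᵐᵒᵖ I := hher I
  let G1 : I := ⟨g1, Submodule.subset_span (by simp)⟩
  let G2 : I := ⟨g2, Submodule.subset_span (by simp)⟩
  let f : Rᵐᵒᵖ × Rᵐᵒᵖ →ₗ[Rᵐᵒᵖ] I :=
    (LinearMap.toSpanSingleton Rᵐᵒᵖ I G1).coprod (LinearMap.toSpanSingleton Rᵐᵒᵖ I G2)
  have hf : Function.Surjective f := by
    rintro ⟨x, hx⟩
    obtain ⟨a, b, hab⟩ := Submodule.mem_span_pair.1 hx
    refine ⟨(a, b), Subtype.ext ?_⟩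
    simpa [f, G1, G2] using hab
  obtain ⟨h, hh⟩ := Module.projective_lifting_property f LinearMap.id hf
  have hh' : ∀ x, f (h x) = x := fun x => LinearMap.congr_fun hh x
  have hrel : op s1 • G1 = op s2 • G2 := by
    apply Subtype.ext
    apply Subtype.ext
    change Matrix.single i i L.ϖ * Matrix.single i j (L.ϖ ^ (m i j)) =
      Matrix.single i j (L.ϖ ^ (m i j)) * Matrix.single j j L.ϖ
    rw [Matrix.single_mul_single_same, Matrix.single_mul_single_same]
    congr 1
    rw [← zpow_one_add₀ L.ϖ_ne, ← zpow_add_one₀ L.ϖ_ne, add_comm]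
  have hX := congrArg (fun z => (h z).1) hrel
  simp only [map_smul, Prod.smul_fst] at hX
  have hX1 : (h G1).1.unop.1 * s1.1 = (h G2).1.unop.1 * s2.1 :=
    congrArg (fun z : Rᵐᵒᵖ => z.unop.1) hX
  have hX2 := congrFun (congrFun hX1 i) j
  simp only [s1, s2, Matrix.mul_single_apply_same] at hX2
  have hG := congrArg (fun z : I => z.1.1) (hh' G1)
  have hG1 : g1.1 * (h G1).1.unop.1 + g2.1 * (h G1).2.unop.1 = g1.1 := hG
  have hG2 := congrFun (congrFun hG1 i) i
  simp only [g1, g2, Matrix.add_apply, Matrix.single_mul_apply_same,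
    Matrix.single_apply_same] at hG2
  have hXij : (h G2).1.unop.1 i j ∈ L.Ppow (m i j) := (h G2).1.unop.2 i j
  have hYji : (h G1).2.unop.1 j i ∈ L.Ppow (m j i) := (h G1).2.unop.2 j i
  have hXii : (h G1).1.unop.1 i i ∈ L.Ppow 1 := by
    have e : (h G1).1.unop.1 i i = (h G2).1.unop.1 i j * L.ϖ * (L.ϖ ^ (-(m i j))) := by
      rw [← hX2, mul_assoc, ← zpow_add₀ L.ϖ_ne]; simp
    rw [e]
    exact L.Ppow_mono (by omega) (L.Ppow_mul_mem (L.Ppow_mul_mem hXij hϖ1) (L.zpow_mem _))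
  have : L.ϖ ∈ L.Ppow 2 := by
    rw [← hG2]
    exact L.Ppow_add_mem (L.Ppow_mono (by omega) (L.Ppow_mul_mem hϖ1 hXii))
      (L.Ppow_mono (by omega) (L.Ppow_mul_mem (L.zpow_mem _) hYji))
  rw [L.mem_Ppow_of_ne L.ϖ_ne, L.w_ϖ] at this
  omega

open MulOpposite in
theorem projective_aux (h0 : ∀ i, m i i = 0) (htri : ∀ i j k, m i k ≤ m i j + m j k)
    (hH : ∀ i j, m i j + m j i ≤ 1) (S : Finset (Fin n)) :
    ∀ J : Submodule (↥(L.stdOrder m (id : Fin n → Fin n) h0 htri))ᵐᵒᵖ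
      ↥(L.stdOrder m (id : Fin n → Fin n) h0 htri),
      (∀ x ∈ J, ∀ a, a ∉ S → ∀ b, x.1 a b = 0) →
        Module.Projective (↥(L.stdOrder m (id : Fin n → Fin n) h0 htri))ᵐᵒᵖ J := by
  classical
  induction S using Finset.induction_on with
  | empty =>
    intro J hJ
    have : Subsingleton J := by
      constructor
      rintro ⟨x, hx⟩ ⟨y, hy⟩
      apply Subtype.ext
      apply Subtype.ext
      ext a b
      rw [hJ x hx a (by simp), hJ y hy a (by simp)]
    infer_instance
  | insert k S hkS ih =>
    intro J hJ
    let R := ↥(L.stdOrder m (id : Fin n → Fin n) h0 htri)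
    by_cases hz : ∀ x ∈ J, ∀ b, x.1 k b = 0
    · refine ih J fun x hx a ha b => ?_
      by_cases hak : a = k
      · rw [hak]; exact hz x hx b
      · exact hJ x hx a (by simp [hak, ha]) b
    push Not at hz
    obtain ⟨x0, hx0, b0, hb0⟩ := hz
    -- minimal valuations
    have hmin : ∀ l, (∃ x ∈ J, x.1 k l ≠ 0) → ∃ x ∈ J, x.1 k l ≠ 0 ∧
        ∀ y ∈ J, y.1 k l ≠ 0 → L.w (x.1 k l) ≤ L.w (y.1 k l) := by
      rintro l ⟨x, hx, hxl⟩
      obtain ⟨c, ⟨y, hy, hyl, rfl⟩, hc⟩ := Int.exists_least_of_bdd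
        (P := fun c => ∃ y ∈ J, y.1 k l ≠ 0 ∧ L.w (y.1 k l) = c)
        ⟨m k l, by
          rintro z ⟨y, hy, hyl, rfl⟩
          exact (L.mem_Ppow_of_ne hyl).1 (y.2 k l)⟩ ⟨_, x, hx, hxl, rfl⟩
      exact ⟨y, hy, hyl, fun z hz' hzl => hc _ ⟨z, hz', hzl, rfl⟩⟩
    have hmin' : ∀ l, ∃ x : R, (∃ x ∈ J, x.1 k l ≠ 0) → x ∈ J ∧ x.1 k l ≠ 0 ∧
        ∀ y ∈ J, y.1 k l ≠ 0 → L.w (x.1 k l) ≤ L.w (y.1 k l) := by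
      intro l
      by_cases h : ∃ x ∈ J, x.1 k l ≠ 0
      · obtain ⟨x, hx⟩ := hmin l h
        exact ⟨x, fun _ => hx⟩
      · exact ⟨0, fun h' => absurd h' h⟩
    choose X hX using hmin'
    obtain ⟨l, hl, hlmin⟩ := exists_min_rel
      (fun l j : Fin n => L.w ((X l).1 k l) + m l j ≤ L.w ((X j).1 k j))
      (fun l => by simp [h0])
      (fun a b c h1 h2 => by have := htri a b c; omega)
      (Finset.univ.filter fun l => ∃ x ∈ J, x.1 k l ≠ 0) ⟨b0, by simpa using ⟨x0.1, ⟨x0.2, hx0⟩, hb0⟩⟩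
    rw [Finset.mem_filter] at hl
    obtain ⟨hXJ, hXne, hXmin⟩ := hX l hl.2
    set ζ := (X l).1 k l with hζ
    have key : ∀ x ∈ J, ∀ j, x.1 k j ≠ 0 → L.w ζ + m l j ≤ L.w (x.1 k j) := by
      intro x hx j hxj
      have hF : ∃ x ∈ J, x.1 k j ≠ 0 := ⟨x, hx, hxj⟩
      have h1 := (hX j hF).2.2 x hx hxj
      by_contra hcon
      have h2 := hH l j
      have h3 := hlmin j (by rw [Finset.mem_filter]; exact ⟨Finset.mem_univ _, hF⟩) (by omega)
      omega
    have hsT : ∀ x ∈ J, Matrix.single l k ζ⁻¹ * x.1 ∈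
        L.stdOrder m (id : Fin n → Fin n) h0 htri := by
      intro x hx a b
      by_cases ha : a = l
      · subst ha
        rw [Matrix.single_mul_apply_same]
        by_cases h : x.1 k b = 0
        · rw [h, mul_zero]; exact Or.inl rfl
        · right
          rw [L.w_mul _ _ (inv_ne_zero hXne) h, L.w_inv _ hXne]
          have := key x hx b h
          simp only [id]
          omega
      · rw [Matrix.single_mul_apply_of_ne (h := ha)]; exact Or.inl rfl
    have hell : Matrix.single l l (1 : L.D) ∈ L.stdOrder m (id : Fin n → Fin n) h0 htri := by
      intro a b
      by_cases h : l = a ∧ l = b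
      · obtain ⟨rfl, rfl⟩ := h
        rw [Matrix.single_apply_same]; exact L.Ppow_one_mem (h0 _).le
      · rw [Matrix.single_apply_of_ne (h := h)]; exact Or.inl rfl
    let e : R := ⟨Matrix.single l l 1, hell⟩
    let g : J := ⟨X l * e, J.smul_mem (op e) hXJ⟩
    let J' : Submodule Rᵐᵒᵖ R :=
      { carrier := {x | x ∈ J ∧ ∀ b, x.1 k b = 0}
        zero_mem' := ⟨J.zero_mem, fun b => rfl⟩
        add_mem' := by
          rintro x y ⟨hx, hx'⟩ ⟨hy, hy'⟩
          refine ⟨J.add_mem hx hy, fun b => ?_⟩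
          change x.1 k b + y.1 k b = 0
          rw [hx', hy', add_zero]
        smul_mem' := by
          rintro c x ⟨hx, hx'⟩
          refine ⟨J.smul_mem c hx, fun b => ?_⟩
          change (x.1 * c.unop.1) k b = 0
          rw [Matrix.mul_apply]
          exact Finset.sum_eq_zero fun d _ => by rw [hx', zero_mul] }
    have hJ'J : J' ≤ J := fun x hx => hx.1
    have hJ'P : Module.Projective Rᵐᵒᵖ J' := by
      refine ih J' fun x hx a ha b => ?_
      by_cases hak : a = k
      · rw [hak]; exact hx.2 b
      · exact hJ x hx.1 a (by simp [hak, ha]) b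
    let φ : J →ₗ[Rᵐᵒᵖ] Rᵐᵒᵖ :=
      { toFun := fun x => op ⟨Matrix.single l k ζ⁻¹ * x.1.1, hsT x.1 x.2⟩
        map_add' := by
          intro x y
          apply unop_injective
          apply Subtype.ext
          exact mul_add (Matrix.single l k ζ⁻¹) x.1.1 y.1.1
        map_smul' := by
          intro c x
          apply unop_injective
          apply Subtype.ext
          exact (mul_assoc (Matrix.single l k ζ⁻¹) x.1.1 c.unop.1).symm }
    let ψ : Rᵐᵒᵖ →ₗ[Rᵐᵒᵖ] J := LinearMap.toSpanSingleton Rᵐᵒᵖ J g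
    let θ : J →ₗ[Rᵐᵒᵖ] J' := LinearMap.codRestrict J' (J.subtype ∘ₗ ((LinearMap.id : J →ₗ[Rᵐᵒᵖ] J) - ψ ∘ₗ φ)) (by
      intro x
      refine ⟨(((LinearMap.id : J →ₗ[Rᵐᵒᵖ] J) - ψ ∘ₗ φ) x).2, fun b => ?_⟩
      change x.1.1 k b - ((X l).1 * Matrix.single l l (1 : L.D) *
        (Matrix.single l k ζ⁻¹ * x.1.1) : Matrix (Fin n) (Fin n) L.D) k b = 0
      rw [← mul_assoc, mul_assoc (X l).1, Matrix.single_mul_single_same, one_mul, mul_assoc,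
        Matrix.mul_apply, Finset.sum_eq_single l]
      · rw [Matrix.single_mul_apply_same, ← hζ, mul_inv_cancel_left₀ hXne, sub_self]
      · intro c _ hc
        rw [Matrix.single_mul_apply_of_ne (h := hc), mul_zero]
      · intro h; exact absurd (Finset.mem_univ _) h)
    refine Module.Projective.of_split (θ.prod φ) ((Submodule.inclusion hJ'J).coprod ψ) ?_
    apply LinearMap.ext
    intro x
    apply Subtype.ext
    change (x.1 - (ψ (φ x)).1) + (ψ (φ x)).1 = x.1
    exact sub_add_cancel _ _

theorem hereditary_std (h0 : ∀ i, m i i = 0) (htri : ∀ i j k, m i k ≤ m i j + m j k)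
    (hH : ∀ i j, m i j + m j i ≤ 1) :
    IsHereditaryRing ↥(L.stdOrder m (id : Fin n → Fin n) h0 htri) := by
  intro J
  exact projective_aux h0 htri hH Finset.univ J (by simp)

end LocalCSA
end Paper

open Paper Paper.LocalCSA in
/-- Let `O` be a tiled local order in `M_n(D_p)`. Then `O^•` has
finite elasticity if and only if `O` is hereditary. -/
theorem tiled_local_order_finite_elasticity_iff_hereditary (L : LocalCSA) (n : ℕ)
    (O : Subring (Matrix (Fin n) (Fin n) L.D)) (hO : L.IsTiledOrder O) :
    elasticity ↥(L.matDot O) < ⊤ ↔ IsHereditaryRing ↥O := by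
  obtain ⟨u, m, h0, htri, hmem⟩ := L.exists_std O hO
  have hmem' : ∀ C, C ∈ O ↔ L.InT m ((u⁻¹).val * C * u.val) := by
    intro C
    have := hmem ((u⁻¹).val * C * u.val)
    have e : u.val * ((u⁻¹).val * C * u.val) * (u⁻¹).val = C := by
      rw [mul_assoc, mul_assoc, mul_assoc, u.mul_inv, mul_one, ← mul_assoc, u.mul_inv, one_mul]
    rw [e] at this
    exact this
  have c1 : ∀ C : Matrix (Fin n) (Fin n) L.D, u.val * ((u⁻¹).val * C * u.val) * (u⁻¹).val = C := by
    intro C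
    rw [mul_assoc, mul_assoc, mul_assoc, u.mul_inv, mul_one, ← mul_assoc, u.mul_inv, one_mul]
  have c2 : ∀ C : Matrix (Fin n) (Fin n) L.D, (u⁻¹).val * (u.val * C * (u⁻¹).val) * u.val = C := by
    intro C
    rw [mul_assoc, mul_assoc, mul_assoc, u.inv_mul, mul_one, ← mul_assoc, u.inv_mul, one_mul]
  have cm : ∀ B C : Matrix (Fin n) (Fin n) L.D, u.val * (B * C) * (u⁻¹).val =
      (u.val * B * (u⁻¹).val) * (u.val * C * (u⁻¹).val) := by
    intro B C
    calc _ = u.val * B * ((u⁻¹).val * u.val) * C * (u⁻¹).val := by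
          rw [u.inv_mul, mul_one, mul_assoc u.val B C]
      _ = _ := by simp only [mul_assoc]
  have cu : ∀ B : Matrix (Fin n) (Fin n) L.D, L.nrd B ≠ 0 → L.nrd (u.val * B * (u⁻¹).val) ≠ 0 := by
    intro B hB
    rw [L.nrd_unit] at hB ⊢
    exact (u.isUnit.mul hB).mul (u⁻¹).isUnit
  have cu' : ∀ B : Matrix (Fin n) (Fin n) L.D, L.nrd B ≠ 0 → L.nrd ((u⁻¹).val * B * u.val) ≠ 0 := by
    intro B hB
    rw [L.nrd_unit] at hB ⊢
    exact ((u⁻¹).isUnit.mul hB).mul u.isUnit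
  let T := L.stdOrder m (id : Fin n → Fin n) h0 htri
  let eR : ↥T ≃+* ↥O :=
    { toFun := fun B => ⟨u.val * B.1 * (u⁻¹).val, (hmem B.1).2 B.2⟩
      invFun := fun C => ⟨(u⁻¹).val * C.1 * u.val, (hmem' C.1).1 C.2⟩
      left_inv := fun B => Subtype.ext (c2 B.1)
      right_inv := fun C => Subtype.ext (c1 C.1)
      map_mul' := fun B C => Subtype.ext (cm B.1 C.1)
      map_add' := fun B C => Subtype.ext (by
        change u.val * (B.1 + C.1) * (u⁻¹).val = u.val * B.1 * (u⁻¹).val + u.val * C.1 * (u⁻¹).val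
        rw [mul_add, add_mul]) }
  let eM : ↥(L.matDot T) ≃* ↥(L.matDot O) :=
    { toFun := fun B => ⟨u.val * B.1 * (u⁻¹).val, (hmem B.1).2 B.2.1, cu _ B.2.2⟩
      invFun := fun C => ⟨(u⁻¹).val * C.1 * u.val, (hmem' C.1).1 C.2.1, cu' _ C.2.2⟩
      left_inv := fun B => Subtype.ext (c2 B.1)
      right_inv := fun C => Subtype.ext (c1 C.1)
      map_mul' := fun B C => Subtype.ext (cm B.1 C.1) }
  obtain ⟨len, hmul, hunit⟩ := L.exists_len O hO.1
  have hmul' : ∀ a b, len (eM (a * b)) = len (eM a) + len (eM b) := fun a b => by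
    rw [map_mul, hmul]
  have hunit' : ∀ a, len (eM a) = 0 ↔ IsUnit a := fun a => by
    rw [hunit, MulEquiv.isUnit_map]
  rw [← elasticity_congr eM]
  by_cases hH : ∀ i j, m i j + m j i ≤ 1
  · exact iff_of_true (elasticity_std_lt_top h0 htri hH (fun a => len (eM a)) hmul' hunit')
      (hereditary_of_ringEquiv eR (hereditary_std h0 htri hH))
  · push Not at hH
    obtain ⟨i, j, hij⟩ := hH
    refine iff_of_false ?_ ?_
    · rw [elasticity_std_eq_top h0 htri (fun a => len (eM a)) hmul' hunit' i j (by omega)]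
      exact lt_irrefl _
    · intro h
      exact not_hereditary_std h0 htri i j (by omega) (hereditary_of_ringEquiv eR.symm h)
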